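/- arXiv:1303.5171 — 2 statements merged into one kernel-verified Lean document; each statement's English description precedes it below -/
import Mathlib

section
/- Let k ≥ 1 be a fixed integer and p(n) = (log n + (k+1)·log log n − log log log n)/n. Then almost surely k ≤ κ(G(n, p(n))) ≤ k + 1, where κ denotes the vertex connectivity. -/
open Filter Asymptotics
open scoped Classical

noncomputable section

/-- The number of edges of a simple graph on a finite vertex type. -/
def edgeCount {V : Type*} [Fintype V] (G : SimpleGraph V) : ℕ :=
  G.edgeFinset.card

/-- Probability in the Erdős–Rényi model `G(n,p)` of a set `A` of graphs on `Fin n`: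
each of the `n.choose 2` possible edges is present independently with probability `p`. -/
def gnpProb (n : ℕ) (p : ℝ) (A : Set (SimpleGraph (Fin n))) : ℝ :=
  ∑ G ∈ Finset.univ.filter (fun G => G ∈ A),
    p ^ edgeCount G * (1 - p) ^ (n.choose 2 - edgeCount G)

/-- Probability in the uniform model `G(n,M)` of a set `A` of graphs on `Fin n`:
all graphs with exactly `M` edges are equally likely. -/
def gnmProb (n M : ℕ) (A : Set (SimpleGraph (Fin n))) : ℝ :=
  ((Finset.univ.filter (fun G : SimpleGraph (Fin n) => edgeCount G = M ∧ G ∈ A)).card : ℝ) /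
    ((Finset.univ.filter (fun G : SimpleGraph (Fin n) => edgeCount G = M)).card : ℝ)

/-- `κ(S)`: the largest number of internally disjoint trees connecting `S`, i.e. trees
`T₁, …, T_k` of `G` with `S ⊆ V(Tᵢ)`, `V(Tᵢ) ∩ V(Tⱼ) = S` and `E(Tᵢ) ∩ E(Tⱼ) = ∅`
for `i ≠ j`. -/
def kappaSet {V : Type*} (G : SimpleGraph V) (S : Set V) : ℕ :=
  sSup {k | ∃ T : Fin k → G.Subgraph,
    (∀ i, S ⊆ (T i).verts ∧ ((T i).coe).IsTree) ∧
    (∀ i j, i ≠ j → (T i).verts ∩ (T j).verts = S ∧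
      (T i).edgeSet ∩ (T j).edgeSet = ∅)}

/-- `λ(S)`: the largest number of pairwise edge-disjoint trees of `G` each containing `S`. -/
def lambdaSet {V : Type*} (G : SimpleGraph V) (S : Set V) : ℕ :=
  sSup {k | ∃ T : Fin k → G.Subgraph,
    (∀ i, S ⊆ (T i).verts ∧ ((T i).coe).IsTree) ∧
    (∀ i j, i ≠ j → (T i).edgeSet ∩ (T j).edgeSet = ∅)}

/-- The generalized `r`-connectivity `κ_r(G)`: the minimum of `κ(S)` over `r`-subsets `S`,
and `0` if `G` is disconnected. -/
def genKappa {V : Type*} [Fintype V] (r : ℕ) (G : SimpleGraph V) : ℕ :=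
  if G.Connected then
    sInf {k | ∃ S : Finset V, S.card = r ∧ kappaSet G ↑S = k}
  else 0

/-- The generalized `r`-edge-connectivity `λ_r(G)`: the minimum of `λ(S)` over
`r`-subsets `S`, and `0` if `G` is disconnected. -/
def genLambda {V : Type*} [Fintype V] (r : ℕ) (G : SimpleGraph V) : ℕ :=
  if G.Connected then
    sInf {k | ∃ S : Finset V, S.card = r ∧ lambdaSet G ↑S = k}
  else 0

/-- The vertex connectivity `κ(G)`: the largest `k` such that `G` is `k`-connected,
i.e. `k < |V|` and the removal of fewer than `k` vertices leaves a connected graph. -/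
def vertexConnectivity {V : Type*} [Fintype V] (G : SimpleGraph V) : ℕ :=
  sSup {k | k < Fintype.card V ∧
    ∀ S : Finset V, S.card < k → (G.induce ((↑S : Set V)ᶜ)).Connected}

/-- The edge connectivity `λ(G)`: the largest `k` such that removing fewer than `k`
edges always leaves a connected graph. -/
def edgeConnectivity {V : Type*} [Fintype V] (G : SimpleGraph V) : ℕ :=
  sSup {k | ∀ F : Finset (Sym2 V), F.card < k → (G.deleteEdges ↑F).Connected}

/-- The minimum degree `δ(G)`. -/
def minDeg {V : Type*} [Fintype V] (G : SimpleGraph V) : ℕ :=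
  G.minDegree

/-- The number of children of `v` in the graph `H` viewed as rooted at `r`:
neighbours of `v` lying one step further from the root. -/
def childCount {W : Type*} (H : SimpleGraph W) (r v : W) : ℕ :=
  {w | H.Adj v w ∧ H.dist r w = H.dist r v + 1}.ncard

/-- The depth of the graph `H` viewed as rooted at `r`: the largest distance from `r`. -/
def rootedDepth {W : Type*} (H : SimpleGraph W) (r : W) : ℕ :=
  sSup (Set.range (H.dist r))

/-- `T` is a subtree of `G` rooted at `r`, of depth `d`, in which every non-leaf
vertex has exactly `t` children (a `t`-ary tree of depth `d`). -/
def IsAryTreeOfDepth {V : Type*} {G : SimpleGraph V} (T : G.Subgraph) (r : V)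
    (t d : ℕ) : Prop :=
  ∃ hr : r ∈ T.verts,
    T.coe.IsTree ∧ rootedDepth T.coe ⟨r, hr⟩ = d ∧
      ∀ v : T.verts, childCount T.coe ⟨r, hr⟩ v = 0 ∨ childCount T.coe ⟨r, hr⟩ v = t

end

noncomputable section

/-- The probability of a single graph in the model `G(n,p)`. -/
def gnpWeight (n : ℕ) (p : ℝ) (G : SimpleGraph (Fin n)) : ℝ :=
  p ^ edgeCount G * (1 - p) ^ (n.choose 2 - edgeCount G)

/-- The graphs containing all the pairs in `P` and none of the pairs in `Q` as edges. -/
def edgeCylinder {n : ℕ} (P Q : Finset (Sym2 (Fin n))) : Set (SimpleGraph (Fin n)) :=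
  {G | (∀ e ∈ P, e ∈ G.edgeSet) ∧ ∀ e ∈ Q, e ∉ G.edgeSet}

end

section RandomGraph

variable {n : ℕ} {p : ℝ}

lemma gnpProb_eq_sum_weight (A : Set (SimpleGraph (Fin n))) :
    gnpProb n p A = ∑ G ∈ Finset.univ.filter (fun G => G ∈ A), gnpWeight n p G := rfl

lemma gnpWeight_nonneg (h0 : 0 ≤ p) (h1 : p ≤ 1) (G : SimpleGraph (Fin n)) :
    0 ≤ gnpWeight n p G :=
  mul_nonneg (pow_nonneg h0 _) (pow_nonneg (by linarith) _)

lemma mem_edgeCylinder {P Q : Finset (Sym2 (Fin n))} {G : SimpleGraph (Fin n)} :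
    G ∈ edgeCylinder P Q ↔ (∀ e ∈ P, e ∈ G.edgeSet) ∧ ∀ e ∈ Q, e ∉ G.edgeSet := Iff.rfl

lemma gnpProb_mono (h0 : 0 ≤ p) (h1 : p ≤ 1) {A B : Set (SimpleGraph (Fin n))} (h : A ⊆ B) :
    gnpProb n p A ≤ gnpProb n p B := by
  refine Finset.sum_le_sum_of_subset_of_nonneg ?_ fun G _ _ => gnpWeight_nonneg h0 h1 G
  intro G hG
  simp only [Finset.mem_filter, Finset.mem_univ, true_and] at hG ⊢
  exact h hG

lemma gnpProb_iUnion_le {ι : Type*} (h0 : 0 ≤ p) (h1 : p ≤ 1) (s : Finset ι)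
    (A : ι → Set (SimpleGraph (Fin n))) :
    gnpProb n p {G | ∃ i ∈ s, G ∈ A i} ≤ ∑ i ∈ s, gnpProb n p (A i) := by
  simp only [gnpProb_eq_sum_weight, Finset.sum_filter]
  rw [Finset.sum_comm]
  refine Finset.sum_le_sum fun G _ => ?_
  have hw := gnpWeight_nonneg h0 h1 G
  split_ifs with hG
  · obtain ⟨i, hi, hGi⟩ := hG
    calc gnpWeight n p G = if G ∈ A i then gnpWeight n p G else 0 := by rw [if_pos hGi]
      _ ≤ _ := Finset.single_le_sum (f := fun i => if G ∈ A i then gnpWeight n p G else 0)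
          (fun j _ => by split_ifs <;> simp [hw]) hi
  · exact Finset.sum_nonneg fun j _ => by split_ifs <;> simp [hw]

lemma edgeSet_fromEdgeSet_of_not_isDiag {V : Type*} {s : Set (Sym2 V)}
    (hs : ∀ e ∈ s, ¬ e.IsDiag) : (SimpleGraph.fromEdgeSet s).edgeSet = s := by
  rw [SimpleGraph.edgeSet_fromEdgeSet]
  ext e
  simpa using fun he => hs e he

lemma gnpProb_edgeCylinder {P Q : Finset (Sym2 (Fin n))} (hP : ∀ e ∈ P, ¬ e.IsDiag)
    (hQ : ∀ e ∈ Q, ¬ e.IsDiag) (hPQ : Disjoint P Q) :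
    gnpProb n p (edgeCylinder P Q) = p ^ P.card * (1 - p) ^ Q.card := by
  set E : Finset (Sym2 (Fin n)) := (⊤ : SimpleGraph (Fin n)).edgeFinset with hE
  have hEmem : ∀ e, e ∈ E ↔ ¬ e.IsDiag := fun e => by simp [hE]
  have hEcard : E.card = n.choose 2 := by
    rw [hE, SimpleGraph.card_edgeFinset_top_eq_card_choose_two, Fintype.card_fin]
  set R : Finset (Sym2 (Fin n)) := (E \ P) \ Q with hR
  have hRcard : P.card + Q.card + R.card = n.choose 2 := by
    rw [← hEcard, hR, sdiff_sdiff, Finset.sup_eq_union, ← Finset.card_union_of_disjoint hPQ, add_comm]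
    refine Finset.card_sdiff_add_card_eq_card fun e he => (hEmem e).2 ?_
    rcases Finset.mem_union.1 he with h | h
    exacts [hP e h, hQ e h]
  have hedge : ∀ t ∈ R.powerset,
      (SimpleGraph.fromEdgeSet (↑(P ∪ t) : Set (Sym2 (Fin n)))).edgeSet = ↑(P ∪ t) := by
    intro t ht
    refine edgeSet_fromEdgeSet_of_not_isDiag fun e he => ?_
    rcases Finset.mem_union.1 (Finset.mem_coe.1 he) with h | h
    · exact hP e h
    · have := Finset.mem_powerset.1 ht h
      simp only [hR, Finset.mem_sdiff] at this
      exact (hEmem e).1 this.1.1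
  calc gnpProb n p (edgeCylinder P Q)
      = ∑ t ∈ R.powerset, p ^ P.card * (1 - p) ^ Q.card *
          (p ^ t.card * (1 - p) ^ (R.card - t.card)) := by
        refine Finset.sum_nbij' (fun G => Finset.univ.filter (fun e => e ∈ G.edgeSet) \ P)
          (fun t => SimpleGraph.fromEdgeSet (↑(P ∪ t) : Set (Sym2 (Fin n)))) ?_ ?_ ?_ ?_ ?_
        · intro G hG
          simp only [Finset.mem_filter, Finset.mem_univ, true_and,
            mem_edgeCylinder] at hG
          refine Finset.mem_powerset.2 fun e he => ?_
          simp only [Finset.mem_sdiff, Finset.mem_filter, Finset.mem_univ, true_and] at he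
          simp only [hR, Finset.mem_sdiff, hEmem]
          exact ⟨⟨G.not_isDiag_of_mem_edgeSet he.1, he.2⟩, fun h => hG.2 e h he.1⟩
        · intro t ht
          simp only [Finset.mem_filter, Finset.mem_univ, true_and,
            mem_edgeCylinder, hedge t ht, Finset.mem_coe, Finset.mem_union, not_or]
          refine ⟨fun e he => Or.inl he, fun e he => ⟨fun h => ?_, fun h => ?_⟩⟩
          · exact Finset.disjoint_left.1 hPQ h he
          · exact (Finset.mem_sdiff.1 (Finset.mem_powerset.1 ht h)).2 he
        · intro G hG
          simp only [Finset.mem_filter, Finset.mem_univ, true_and,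
            mem_edgeCylinder] at hG
          rw [Finset.union_sdiff_of_subset, Finset.coe_filter]
          · simp
          · exact fun e he => by simpa using hG.1 e he
        · intro t ht
          have hPt : Disjoint P t := Finset.disjoint_right.2 fun e he => by
            have := Finset.mem_powerset.1 ht he
            simp only [hR, Finset.mem_sdiff] at this
            exact this.1.2
          ext e
          simp only [Finset.mem_sdiff, Finset.mem_filter, Finset.mem_univ, true_and, hedge t ht,
            Finset.mem_coe, Finset.mem_union]
          have : e ∈ t → e ∉ P := fun h => Finset.disjoint_right.1 hPt h
          tauto
        · intro G hG
          simp only [Finset.mem_filter, Finset.mem_univ, true_and,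
            mem_edgeCylinder] at hG
          set F := Finset.univ.filter (fun e => e ∈ G.edgeSet) with hF
          have hsub : P ⊆ F := fun e he => by simpa [hF] using hG.1 e he
          have hc : (F \ P).card + P.card = edgeCount G := by
            rw [Finset.card_sdiff_add_card_eq_card hsub, edgeCount]
            congr 1
            ext e
            simp [hF]
          have hle : (F \ P).card ≤ R.card := by
            refine Finset.card_le_card fun e he => ?_
            simp only [hF, Finset.mem_sdiff, Finset.mem_filter, Finset.mem_univ, true_and] at he
            simp only [hR, Finset.mem_sdiff, hEmem]
            exact ⟨⟨G.not_isDiag_of_mem_edgeSet he.1, he.2⟩, fun h => hG.2 e h he.1⟩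
          have h2 : n.choose 2 - edgeCount G = Q.card + (R.card - (F \ P).card) := by
            omega
          rw [h2, ← hc, pow_add, pow_add]
          ring
    _ = _ := by
        rw [← Finset.mul_sum, Finset.sum_pow_mul_eq_add_pow]
        simp

lemma gnpProb_univ : gnpProb n p Set.univ = 1 := by
  have h := gnpProb_edgeCylinder (n := n) (p := p) (P := ∅) (Q := ∅) (by simp) (by simp) (by simp)
  have h2 : edgeCylinder (∅ : Finset (Sym2 (Fin n))) ∅ = Set.univ := by
    ext G; simp [edgeCylinder]
  simpa [h2] using h

lemma gnpProb_compl (A : Set (SimpleGraph (Fin n))) :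
    gnpProb n p Aᶜ = 1 - gnpProb n p A := by
  rw [← gnpProb_univ (n := n) (p := p)]
  simp only [gnpProb_eq_sum_weight, Set.mem_compl_iff, Set.mem_univ, Finset.filter_true]
  rw [eq_sub_iff_add_eq, add_comm, Finset.sum_filter_add_sum_filter_not]

/-- Chebyshev's inequality for the event that a random variable vanishes. -/
lemma gnpProb_eq_zero_mul_sq_le (h0 : 0 ≤ p) (h1 : p ≤ 1) (X : SimpleGraph (Fin n) → ℝ) :
    gnpProb n p {G | X G = 0} * (∑ G, gnpWeight n p G * X G) ^ 2 ≤
      ∑ G, gnpWeight n p G * X G ^ 2 - (∑ G, gnpWeight n p G * X G) ^ 2 := by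
  obtain ⟨μ, hμ⟩ : ∃ μ, μ = ∑ G, gnpWeight n p G * X G := ⟨_, rfl⟩
  rw [← hμ]
  have htot : ∑ G, gnpWeight n p G = 1 := by
    have := gnpProb_univ (n := n) (p := p)
    simpa [gnpProb_eq_sum_weight] using this
  calc gnpProb n p {G | X G = 0} * μ ^ 2
      = ∑ G ∈ Finset.univ.filter (fun G => G ∈ {G | X G = 0}), gnpWeight n p G * (X G - μ) ^ 2 := by
        rw [gnpProb_eq_sum_weight, Finset.sum_mul]
        refine Finset.sum_congr rfl fun G hG => ?_
        have : X G = 0 := by simpa using hG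
        rw [this]; ring
    _ ≤ ∑ G, gnpWeight n p G * (X G - μ) ^ 2 :=
        Finset.sum_le_sum_of_subset_of_nonneg (Finset.filter_subset _ _)
          fun G _ _ => mul_nonneg (gnpWeight_nonneg h0 h1 G) (sq_nonneg _)
    _ = ∑ G, gnpWeight n p G * X G ^ 2 - 2 * μ * (∑ G, gnpWeight n p G * X G)
          + μ ^ 2 * ∑ G, gnpWeight n p G := by
        rw [Finset.mul_sum, Finset.mul_sum, ← Finset.sum_sub_distrib, ← Finset.sum_add_distrib]
        exact Finset.sum_congr rfl fun G _ => by ring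
    _ = _ := by rw [← hμ, htot]; ring

lemma vertexConnectivity_le_of_neighborSet_subset {k : ℕ} (G : SimpleGraph (Fin n)) (v : Fin n)
    (D : Finset (Fin n)) (hv : v ∉ D) (hD : D.card ≤ k) (hk : k + 1 < n)
    (hG : ∀ w, G.Adj v w → w ∈ D) : vertexConnectivity G ≤ k := by
  refine csSup_le' ?_
  rintro m ⟨-, hm⟩
  by_contra! hlt
  have hconn := hm D (by omega)
  obtain ⟨w, hw⟩ : ∃ w, w ∉ insert v D := by
    by_contra! hall
    have h1 : (insert v D).card = n := by
      rw [Finset.eq_univ_iff_forall.2 hall, Finset.card_univ, Fintype.card_fin]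
    have h2 := Finset.card_insert_le v D
    omega
  simp only [Finset.mem_insert, not_or] at hw
  have hv' : v ∈ (↑D : Set (Fin n))ᶜ := by simpa using hv
  have hw' : w ∈ (↑D : Set (Fin n))ᶜ := by simpa using hw.2
  obtain ⟨W⟩ := hconn.preconnected ⟨v, hv'⟩ ⟨w, hw'⟩
  cases W with
  | nil => exact hw.1 rfl
  | cons h _ =>
    rename_i u _
    exact u.2 (hG u h)

/-- A separator of size less than `k` yields a vertex set `A` on the smaller side whose outer
neighbourhood `S` has fewer than `k` vertices. -/
lemma exists_small_boundary_of_vertexConnectivity_lt {k : ℕ} (G : SimpleGraph (Fin n))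
    (hkn : k < n) (hG : vertexConnectivity G < k) :
    ∃ A S : Finset (Fin n), A.Nonempty ∧ Disjoint A S ∧ S.card < k ∧ 2 * A.card + S.card ≤ n ∧
      (∀ s ∈ S, ∃ a ∈ A, G.Adj a s) ∧ ∀ a ∈ A, ∀ b, b ∉ A → b ∉ S → ¬ G.Adj a b := by
  have hnot : ¬ ∀ S : Finset (Fin n), S.card < k → (G.induce ((↑S : Set (Fin n))ᶜ)).Connected := by
    intro h
    refine absurd (le_csSup ?_ ?_) (not_le.2 hG)
    · exact ⟨Fintype.card (Fin n), fun m hm => hm.1.le⟩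
    · exact ⟨by simpa using hkn, h⟩
  push Not at hnot
  obtain ⟨T, hT, hTG⟩ := hnot
  have key : ∀ A B : Finset (Fin n), A.Nonempty → Disjoint A T → Disjoint A B → Disjoint B T →
      A.card ≤ B.card → (∀ a ∈ A, ∀ b, b ∉ A → b ∉ T → ¬ G.Adj a b) →
      ∃ A S : Finset (Fin n), A.Nonempty ∧ Disjoint A S ∧ S.card < k ∧ 2 * A.card + S.card ≤ n ∧
      (∀ s ∈ S, ∃ a ∈ A, G.Adj a s) ∧ ∀ a ∈ A, ∀ b, b ∉ A → b ∉ S → ¬ G.Adj a b := by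
    intro A B hA hAT hAB hBT hle hadj
    have hsub : T.filter (fun s => ∃ a ∈ A, G.Adj a s) ⊆ T := Finset.filter_subset _ _
    have hcard := Finset.card_le_card hsub
    refine ⟨A, T.filter (fun s => ∃ a ∈ A, G.Adj a s), hA, hAT.mono_right hsub, by omega, ?_, ?_, ?_⟩
    · have h1 : (A ∪ B ∪ T).card = A.card + B.card + T.card := by
        rw [Finset.card_union_of_disjoint, Finset.card_union_of_disjoint hAB]
        exact Finset.disjoint_union_left.2 ⟨hAT, hBT⟩
      have h2 := Finset.card_le_univ (A ∪ B ∪ T)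
      rw [Fintype.card_fin] at h2
      omega
    · intro s hs
      exact (Finset.mem_filter.1 hs).2
    · intro a ha b hbA hbS hab
      by_cases hbT : b ∈ T
      · exact hbS (Finset.mem_filter.2 ⟨hbT, a, ha, hab⟩)
      · exact hadj a ha b hbA hbT hab
  set H := G.induce ((↑T : Set (Fin n))ᶜ) with hH
  have hne : Nonempty ↑((↑T : Set (Fin n))ᶜ) := by
    by_contra hemp
    have : ∀ v, v ∈ T := fun v => by
      by_contra hv
      exact hemp ⟨⟨v, by simpa using hv⟩⟩
    have h1 : T.card = n := by
      rw [Finset.eq_univ_iff_forall.2 this, Finset.card_univ, Fintype.card_fin]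
    omega
  have hpre : ¬ H.Preconnected := fun h => hTG ⟨h⟩
  rw [SimpleGraph.Preconnected] at hpre
  push Not at hpre
  obtain ⟨x, y, hxy⟩ := hpre
  set A : Finset (Fin n) := Finset.univ.filter
    (fun v => ∃ h : v ∈ (↑T : Set (Fin n))ᶜ, H.Reachable x ⟨v, h⟩) with hA
  set B : Finset (Fin n) := Finset.univ.filter
    (fun v => ∃ h : v ∈ (↑T : Set (Fin n))ᶜ, ¬ H.Reachable x ⟨v, h⟩) with hB
  have hmA : ∀ v, v ∈ A ↔ ∃ h : v ∈ (↑T : Set (Fin n))ᶜ, H.Reachable x ⟨v, h⟩ := by simp [hA]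
  have hmB : ∀ v, v ∈ B ↔ ∃ h : v ∈ (↑T : Set (Fin n))ᶜ, ¬ H.Reachable x ⟨v, h⟩ := by simp [hB]
  have hAT : Disjoint A T := Finset.disjoint_left.2 fun v hv => by
    obtain ⟨h, -⟩ := (hmA v).1 hv
    simpa using h
  have hBT : Disjoint B T := Finset.disjoint_left.2 fun v hv => by
    obtain ⟨h, -⟩ := (hmB v).1 hv
    simpa using h
  have hAB : Disjoint A B := Finset.disjoint_left.2 fun v hv hv' => by
    obtain ⟨h, h1⟩ := (hmA v).1 hv
    obtain ⟨_, h2⟩ := (hmB v).1 hv'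
    exact h2 h1
  have hno : ∀ a ∈ A, ∀ b ∈ B, ¬ G.Adj a b := by
    intro a ha b hb hab
    obtain ⟨h, h1⟩ := (hmA a).1 ha
    obtain ⟨h', h2⟩ := (hmB b).1 hb
    have hadj : H.Adj ⟨a, h⟩ ⟨b, h'⟩ := hab
    exact h2 (h1.trans hadj.reachable)
  have hcov : ∀ b, b ∉ T → b ∈ A ∨ b ∈ B := by
    intro b hb
    have hb' : b ∈ (↑T : Set (Fin n))ᶜ := by simpa using hb
    by_cases h : H.Reachable x ⟨b, hb'⟩
    · exact Or.inl ((hmA b).2 ⟨hb', h⟩)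
    · exact Or.inr ((hmB b).2 ⟨hb', h⟩)
  have hAne : A.Nonempty := ⟨x, (hmA x).2 ⟨x.2, SimpleGraph.Reachable.refl _⟩⟩
  have hBne : B.Nonempty := ⟨y, (hmB y).2 ⟨y.2, hxy⟩⟩
  rcases le_total A.card B.card with hle | hle
  · exact key A B hAne hAT hAB hBT hle fun a ha b hbA hbT =>
      hno a ha b ((hcov b hbT).resolve_left hbA)
  · exact key B A hBne hBT hAB.symm hAT hle fun b hb a haB haT hba =>
      hno a ((hcov a haT).resolve_right haB) b hb hba.symm

/-- The graphs in which `S` is the outer neighbourhood of `A`. -/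
def outerNeighborhoodEvent (A S : Finset (Fin n)) : Set (SimpleGraph (Fin n)) :=
  {G | (∀ s ∈ S, ∃ a ∈ A, G.Adj a s) ∧ ∀ a ∈ A, ∀ b, b ∉ A → b ∉ S → ¬ G.Adj a b}

/-- The pairs between `A` and the complement of `A ∪ S`. -/
def crossingPairs (A S : Finset (Fin n)) : Finset (Sym2 (Fin n)) :=
  (A ×ˢ (A ∪ S)ᶜ).image fun x => s(x.1, x.2)

lemma mem_crossingPairs {A S : Finset (Fin n)} {e : Sym2 (Fin n)} :
    e ∈ crossingPairs A S ↔ ∃ a ∈ A, ∃ b, b ∉ A ∧ b ∉ S ∧ s(a, b) = e := by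
  simp only [crossingPairs, Finset.mem_image, Finset.mem_product, Finset.mem_compl,
    Finset.mem_union, not_or, Prod.exists]
  constructor
  · rintro ⟨a, b, ⟨ha, hb, hb'⟩, h⟩
    exact ⟨a, ha, b, hb, hb', h⟩
  · rintro ⟨a, ha, b, hb, hb', h⟩
    exact ⟨a, b, ⟨ha, hb, hb'⟩, h⟩

lemma card_crossingPairs {A S : Finset (Fin n)} (hAS : Disjoint A S) :
    (crossingPairs A S).card = A.card * (n - A.card - S.card) := by
  rw [crossingPairs, Finset.card_image_of_injOn, Finset.card_product, Finset.card_compl,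
    Finset.card_union_of_disjoint hAS, Fintype.card_fin, Nat.sub_sub]
  rintro ⟨a, b⟩ h ⟨a', b'⟩ h' heq
  simp only [Finset.coe_product, Set.mem_prod, Finset.mem_coe, Finset.mem_compl, Finset.mem_union,
    not_or] at h h'
  simp only [Sym2.eq_iff] at heq
  rcases heq with ⟨h1, h2⟩ | ⟨h1, h2⟩
  · simp [h1, h2]
  · exact absurd (h1 ▸ h.1) h'.2.1

lemma not_isDiag_of_mem_crossingPairs {A S : Finset (Fin n)} :
    ∀ e ∈ crossingPairs A S, ¬ e.IsDiag := by
  intro e he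
  obtain ⟨a, ha, b, hb, -, rfl⟩ := mem_crossingPairs.1 he
  rw [Sym2.mk_isDiag_iff]
  rintro rfl
  exact hb ha

lemma gnpProb_outerNeighborhoodEvent_le_pow (h0 : 0 ≤ p) (h1 : p ≤ 1) {A S : Finset (Fin n)}
    (hAS : Disjoint A S) :
    gnpProb n p (outerNeighborhoodEvent A S) ≤ (1 - p) ^ (A.card * (n - A.card - S.card)) := by
  have h := gnpProb_edgeCylinder (n := n) (p := p) (P := ∅) (Q := crossingPairs A S) (by simp)
    not_isDiag_of_mem_crossingPairs (by simp)
  rw [card_crossingPairs hAS, Finset.card_empty, pow_zero, one_mul] at h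
  rw [← h]
  refine gnpProb_mono h0 h1 fun G hG => mem_edgeCylinder.2 ⟨by simp, fun e he => ?_⟩
  obtain ⟨a, ha, b, hb, hb', rfl⟩ := mem_crossingPairs.1 he
  exact hG.2 a ha b hb hb'

lemma gnpProb_outerNeighborhoodEvent_le (h0 : 0 ≤ p) (h1 : p ≤ 1) {A S : Finset (Fin n)}
    (hAS : Disjoint A S) :
    gnpProb n p (outerNeighborhoodEvent A S) ≤
      (A.card : ℝ) ^ S.card * p ^ S.card * (1 - p) ^ (A.card * (n - A.card - S.card)) := by
  set P : (S → A) → Finset (Sym2 (Fin n)) :=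
    fun f => Finset.univ.image fun s : S => s((f s : Fin n), (s : Fin n)) with hP
  have hmemP : ∀ f e, e ∈ P f ↔ ∃ s : S, s((f s : Fin n), (s : Fin n)) = e := by
    intro f e; simp [hP]
  have hSA : ∀ s : S, (s : Fin n) ∉ A := fun s hs => Finset.disjoint_left.1 hAS hs s.2
  have hcard : ∀ f, (P f).card = S.card := by
    intro f
    rw [hP, Finset.card_image_of_injective, Finset.card_univ, Fintype.card_coe]
    intro s t hst
    simp only [Sym2.eq_iff] at hst
    rcases hst with ⟨-, h⟩ | ⟨h, -⟩
    · exact Subtype.ext h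
    · exact absurd (h ▸ (f s).2) (hSA t)
  have hprob : ∀ f, gnpProb n p (edgeCylinder (P f) (crossingPairs A S)) =
      p ^ S.card * (1 - p) ^ (A.card * (n - A.card - S.card)) := by
    intro f
    rw [gnpProb_edgeCylinder, hcard, card_crossingPairs hAS]
    · intro e he
      obtain ⟨s, rfl⟩ := (hmemP f e).1 he
      rw [Sym2.mk_isDiag_iff]
      intro h
      exact hSA s (h ▸ (f s).2)
    · exact not_isDiag_of_mem_crossingPairs
    · refine Finset.disjoint_left.2 fun e he he' => ?_
      obtain ⟨s, rfl⟩ := (hmemP f e).1 he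
      obtain ⟨a, ha, b, hb, hb', h⟩ := mem_crossingPairs.1 he'
      rw [Sym2.eq_iff] at h
      rcases h with ⟨-, h⟩ | ⟨-, h⟩
      · exact hb' (h ▸ s.2)
      · exact hb (h ▸ (f s).2)
  calc gnpProb n p (outerNeighborhoodEvent A S)
      ≤ gnpProb n p {G | ∃ f ∈ (Finset.univ : Finset (S → A)),
          G ∈ edgeCylinder (P f) (crossingPairs A S)} := by
        refine gnpProb_mono h0 h1 fun G hG => ?_
        have hsel : ∀ s : S, ∃ a : A, G.Adj a s := fun s => by
          obtain ⟨a, ha, h⟩ := hG.1 s s.2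
          exact ⟨⟨a, ha⟩, h⟩
        choose f hf using hsel
        refine ⟨f, Finset.mem_univ _, mem_edgeCylinder.2 ⟨fun e he => ?_, fun e he => ?_⟩⟩
        · obtain ⟨s, rfl⟩ := (hmemP f e).1 he
          exact hf s
        · obtain ⟨a, ha, b, hb, hb', rfl⟩ := mem_crossingPairs.1 he
          exact hG.2 a ha b hb hb'
    _ ≤ ∑ f : S → A, gnpProb n p (edgeCylinder (P f) (crossingPairs A S)) :=
        gnpProb_iUnion_le h0 h1 _ _
    _ = _ := by
        simp only [hprob, Finset.sum_const, Finset.card_univ, Fintype.card_fun, Fintype.card_coe,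
          nsmul_eq_mul, Nat.cast_pow]
        ring

lemma one_sub_pow_mul_le_exp {p : ℝ} (h1 : p ≤ 1) (m : ℕ) : (1 - p) ^ m ≤ Real.exp (-(p * m)) := by
  calc (1 - p) ^ m ≤ Real.exp (-p) ^ m :=
        pow_le_pow_left₀ (by linarith) (Real.one_sub_le_exp_neg p) m
    _ = Real.exp (-(p * m)) := by rw [← Real.exp_nat_mul]; ring_nf

/-- The contribution of the pairs `(A, S)` with `#A = a` and `#S = s` to the union bound. -/
lemma smallBoundary_term_le {k a s : ℕ} {L : ℝ} (h0 : 0 ≤ p) (h1 : p ≤ 1) (hL : 1 ≤ L)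
    (hpL : n * p ≤ 2 * L) (hexp : n * Real.exp (-(p * n)) * L ^ k ≤ 1) (hpk : p * k ≤ 1)
    (ha : 1 ≤ a) (hs : s < k) (han : a + s ≤ n) (hap : a * p ≤ 9) :
    (n.choose a : ℝ) * (n.choose s * (a ^ s * p ^ s * (1 - p) ^ (a * (n - a - s)))) ≤
      (4 ^ k * Real.exp 10 / L) ^ a := by
  have hL0 : 0 < L := by linarith
  have hq : (1 - p) ^ (a * (n - a - s)) ≤ (Real.exp (-(p * n)) * Real.exp 10) ^ a := by
    rw [mul_comm a, pow_mul]
    refine pow_le_pow_left₀ (pow_nonneg (by linarith) _) ?_ a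
    refine (one_sub_pow_mul_le_exp h1 _).trans ?_
    rw [← Real.exp_add]
    apply Real.exp_le_exp.2
    have : ((n - a - s : ℕ) : ℝ) = n - a - s := by
      rw [Nat.sub_sub, Nat.cast_sub han]; push_cast; ring
    rw [this]
    have hsk : p * s ≤ p * k := mul_le_mul_of_nonneg_left (by exact_mod_cast hs.le) h0
    nlinarith
  have ha2 : (a : ℝ) ^ s ≤ 2 ^ (k * a) := by
    have h2 : (a : ℝ) ≤ 2 ^ a := by exact_mod_cast Nat.lt_two_pow_self.le
    calc (a : ℝ) ^ s ≤ (2 ^ a) ^ s := pow_le_pow_left₀ (by positivity) h2 s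
      _ = 2 ^ (a * s) := by rw [pow_mul]
      _ ≤ 2 ^ (k * a) := pow_le_pow_right₀ (by norm_num) (by nlinarith)
  have hLs : (2 * L) ^ s ≤ 2 ^ (k * a) * L ^ (k - 1) := by
    rw [mul_pow]
    gcongr
    · norm_num
    · nlinarith
    · omega
  have hLk : L ^ (k - 1) * L ^ a ≤ (L ^ k) ^ a := by
    rw [← pow_add, ← pow_mul]
    refine pow_le_pow_right₀ hL ?_
    obtain ⟨j, rfl⟩ : ∃ j, k = j + 1 := ⟨k - 1, by omega⟩
    obtain ⟨b, rfl⟩ : ∃ b, a = b + 1 := ⟨a - 1, by omega⟩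
    simp only [Nat.add_sub_cancel]
    nlinarith [Nat.zero_le (j * b)]
  have hnexp : ((n : ℝ) * Real.exp (-(p * n))) ^ a * (L ^ (k - 1) * L ^ a) ≤ 1 := by
    calc ((n : ℝ) * Real.exp (-(p * n))) ^ a * (L ^ (k - 1) * L ^ a)
        ≤ ((n : ℝ) * Real.exp (-(p * n))) ^ a * (L ^ k) ^ a := by gcongr
      _ = ((n : ℝ) * Real.exp (-(p * n)) * L ^ k) ^ a := by rw [mul_pow _ (L ^ k)]
      _ ≤ 1 := pow_le_one₀ (by positivity) hexp
  calc (n.choose a : ℝ) * (n.choose s * (a ^ s * p ^ s * (1 - p) ^ (a * (n - a - s))))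
      ≤ (n : ℝ) ^ a * ((n : ℝ) ^ s * (2 ^ (k * a) * p ^ s *
          (Real.exp (-(p * n)) * Real.exp 10) ^ a)) := by
        have hca : (n.choose a : ℝ) ≤ (n : ℝ) ^ a := by exact_mod_cast Nat.choose_le_pow n a
        have hcs : (n.choose s : ℝ) ≤ (n : ℝ) ^ s := by exact_mod_cast Nat.choose_le_pow n s
        have : (0 : ℝ) ≤ (1 - p) ^ (a * (n - a - s)) := pow_nonneg (by linarith) _
        gcongr
    _ = (n * p) ^ s * 2 ^ (k * a) * Real.exp 10 ^ a * (n * Real.exp (-(p * n))) ^ a := by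
        simp only [mul_pow]; ring
    _ ≤ (2 ^ (k * a) * L ^ (k - 1)) * 2 ^ (k * a) * Real.exp 10 ^ a *
          (n * Real.exp (-(p * n))) ^ a := by
        have : (n * p) ^ s ≤ 2 ^ (k * a) * L ^ (k - 1) :=
          (pow_le_pow_left₀ (by positivity) hpL s).trans hLs
        gcongr
    _ = (4 ^ k * Real.exp 10) ^ a / L ^ a *
          ((n * Real.exp (-(p * n))) ^ a * (L ^ (k - 1) * L ^ a)) := by
        have h4 : (4 : ℝ) ^ k = 2 ^ k * 2 ^ k := by rw [← mul_pow]; norm_num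
        rw [mul_pow (4 ^ k), h4, mul_pow (2 ^ k), ← pow_mul]
        field_simp
    _ ≤ (4 ^ k * Real.exp 10) ^ a / L ^ a * 1 := by gcongr
    _ = _ := by rw [mul_one, div_pow]

lemma gnpProb_vertexConnectivity_lt_le {k : ℕ} {L : ℝ} (h0 : 0 ≤ p) (h1 : p ≤ 1) (hL : 1 ≤ L)
    (hpL : n * p ≤ 2 * L) (hexp : n * Real.exp (-(p * n)) * L ^ k ≤ 1) (hpk : p * k ≤ 1)
    (hkn : 3 * k < n) (hKL : 4 ^ k * Real.exp 10 / L ≤ 1 / 2) :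
    gnpProb n p {G | vertexConnectivity G < k} ≤
      k * (2 * (4 ^ k * Real.exp 10 / L)) + Real.exp (-n) := by
  set r := 4 ^ k * Real.exp 10 / L with hr
  have hr0 : 0 ≤ r := by positivity
  set C : Finset (Finset (Fin n) × Finset (Fin n)) := Finset.univ.filter fun x =>
    x.1.Nonempty ∧ Disjoint x.1 x.2 ∧ x.2.card < k ∧ 2 * x.1.card + x.2.card ≤ n with hC
  set g : ℕ → ℕ → ℝ := fun a s => if 1 ≤ a ∧ s < k ∧ a + s ≤ n ∧ a * p ≤ 9 then
    a ^ s * p ^ s * (1 - p) ^ (a * (n - a - s)) else 0 with hg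
  have hg0 : ∀ a s, 0 ≤ g a s := by
    intro a s
    have : (0 : ℝ) ≤ (1 - p) ^ (a * (n - a - s)) := pow_nonneg (by linarith) _
    simp only [hg]
    split_ifs <;> positivity
  have hpair : ∀ x ∈ C, gnpProb n p (outerNeighborhoodEvent x.1 x.2) ≤
      g x.1.card x.2.card + Real.exp (-(3 * n)) := by
    rintro ⟨A, S⟩ hx
    obtain ⟨hA, hAS, hS, hcard⟩ : A.Nonempty ∧ Disjoint A S ∧ S.card < k ∧
      2 * A.card + S.card ≤ n := by simpa [hC] using hx
    by_cases hap : A.card * p ≤ 9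
    · have : g A.card S.card = (A.card : ℝ) ^ S.card * p ^ S.card *
          (1 - p) ^ (A.card * (n - A.card - S.card)) :=
        if_pos ⟨hA.card_pos, hS, by omega, hap⟩
      have h2 := gnpProb_outerNeighborhoodEvent_le h0 h1 hAS
      have := Real.exp_pos (-(3 * n : ℝ))
      simp only
      linarith
    · push Not at hap
      have h2 := (gnpProb_outerNeighborhoodEvent_le_pow h0 h1 hAS).trans
        (one_sub_pow_mul_le_exp h1 _)
      have h3 : Real.exp (-(p * (A.card * (n - A.card - S.card) : ℕ))) ≤ Real.exp (-(3 * n)) := by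
        apply Real.exp_le_exp.2
        have h4 : (n : ℝ) ≤ 3 * (n - A.card - S.card : ℕ) := by
          have : n ≤ 3 * (n - A.card - S.card) := by omega
          exact_mod_cast this
        push_cast
        nlinarith
      have := hg0 A.card S.card
      simp only
      linarith
  have hsum : ∑ x ∈ C, g x.1.card x.2.card ≤ k * (2 * r) := by
    calc ∑ x ∈ C, g x.1.card x.2.card
        ≤ ∑ x : Finset (Fin n) × Finset (Fin n), g x.1.card x.2.card :=
          Finset.sum_le_sum_of_subset_of_nonneg (Finset.filter_subset _ _) fun x _ _ => hg0 _ _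
      _ = ∑ a ∈ Finset.range (n + 1), ∑ s ∈ Finset.range (n + 1),
            (n.choose a : ℝ) * (n.choose s * g a s) := by
          rw [Fintype.sum_prod_type]
          simp only [← Finset.powerset_univ]
          have h2 : ∀ f : ℕ → ℝ, ∑ A ∈ (Finset.univ : Finset (Fin n)).powerset, f A.card =
              ∑ a ∈ Finset.range (n + 1), (n.choose a : ℝ) * f a := by
            intro f
            rw [Finset.sum_powerset_apply_card]
            simp
          rw [h2 fun a => ∑ S ∈ (Finset.univ : Finset (Fin n)).powerset, g a S.card]
          refine Finset.sum_congr rfl fun a _ => ?_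
          rw [h2 fun s => g a s, Finset.mul_sum]
      _ ≤ ∑ a ∈ Finset.range (n + 1), ∑ s ∈ Finset.range (n + 1),
            (if s < k then (if 1 ≤ a then r ^ a else 0) else 0) := by
          refine Finset.sum_le_sum fun a _ => Finset.sum_le_sum fun s _ => ?_
          by_cases h : 1 ≤ a ∧ s < k ∧ a + s ≤ n ∧ a * p ≤ 9
          · simp only [hg, if_pos h, if_pos h.1, if_pos h.2.1]
            exact smallBoundary_term_le h0 h1 hL hpL hexp hpk h.1 h.2.1 h.2.2.1 h.2.2.2
          · simp only [hg, if_neg h, mul_zero]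
            split_ifs <;> positivity
      _ = k * ∑ a ∈ Finset.range (n + 1), (if 1 ≤ a then r ^ a else 0) := by
          rw [Finset.mul_sum]
          refine Finset.sum_congr rfl fun a _ => ?_
          rw [← Finset.sum_filter, Finset.sum_const, nsmul_eq_mul]
          congr 2
          have : (Finset.range (n + 1)).filter (fun s => s < k) = Finset.range k := by
            ext s; simp only [Finset.mem_filter, Finset.mem_range]; omega
          rw [this, Finset.card_range]
      _ ≤ k * (2 * r) := by
          have hshift : ∑ a ∈ Finset.range (n + 1), (if 1 ≤ a then r ^ a else 0) =
              (∑ i ∈ Finset.range n, r ^ i) * r := by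
            rw [Finset.sum_range_succ', Finset.sum_mul]
            simp [pow_succ]
          rw [hshift]
          gcongr
          calc ∑ i ∈ Finset.range n, r ^ i ≤ ∑ i ∈ Finset.range n, (1 / 2 : ℝ) ^ i := by gcongr
            _ ≤ 2 := sum_geometric_two_le n
  have hcardC : (C.card : ℝ) * Real.exp (-(3 * n)) ≤ Real.exp (-n) := by
    have h2 : (C.card : ℝ) ≤ 4 ^ n := by
      have : C.card ≤ 4 ^ n := by
        refine (Finset.card_le_univ C).trans ?_
        rw [Fintype.card_prod, Fintype.card_finset, Fintype.card_fin, ← mul_pow]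
        norm_num
      exact_mod_cast this
    have h4 : (4 : ℝ) ≤ Real.exp 2 := by
      have h5 := Real.exp_one_gt_d9
      have h6 : Real.exp 2 = Real.exp 1 * Real.exp 1 := by rw [← Real.exp_add]; norm_num
      nlinarith
    calc (C.card : ℝ) * Real.exp (-(3 * n)) ≤ Real.exp 2 ^ n * Real.exp (-(3 * n)) := by
          gcongr
          exact h2.trans (pow_le_pow_left₀ (by norm_num) h4 n)
      _ = Real.exp (-n) := by
          rw [← Real.exp_nat_mul, ← Real.exp_add]; ring_nf
  calc gnpProb n p {G | vertexConnectivity G < k}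
      ≤ gnpProb n p {G | ∃ x ∈ C, G ∈ outerNeighborhoodEvent x.1 x.2} := by
        refine gnpProb_mono h0 h1 fun G hG => ?_
        obtain ⟨A, S, hA, hAS, hS, hcard, h5, h6⟩ :=
          exists_small_boundary_of_vertexConnectivity_lt G (by omega) hG
        exact ⟨(A, S), by simp [hC, hA, hAS, hS, hcard], h5, h6⟩
    _ ≤ ∑ x ∈ C, gnpProb n p (outerNeighborhoodEvent x.1 x.2) := gnpProb_iUnion_le h0 h1 _ _
    _ ≤ ∑ x ∈ C, (g x.1.card x.2.card + Real.exp (-(3 * n))) := Finset.sum_le_sum hpair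
    _ ≤ _ := by
        rw [Finset.sum_add_distrib, Finset.sum_const, nsmul_eq_mul]
        linarith

/-- The pairs joining `v` to the vertices of `T`. -/
def starPairs (v : Fin n) (T : Finset (Fin n)) : Finset (Sym2 (Fin n)) :=
  T.image fun w => s(v, w)

lemma mem_starPairs {v : Fin n} {T : Finset (Fin n)} {e : Sym2 (Fin n)} :
    e ∈ starPairs v T ↔ ∃ w ∈ T, s(v, w) = e := Finset.mem_image

lemma mk_mem_starPairs {v w : Fin n} {T : Finset (Fin n)} : s(v, w) ∈ starPairs v T ↔ w ∈ T := by
  rw [mem_starPairs]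
  constructor
  · rintro ⟨x, hx, h⟩
    rwa [← Sym2.congr_right.1 h]
  · exact fun h => ⟨w, h, rfl⟩

lemma card_starPairs (v : Fin n) (T : Finset (Fin n)) : (starPairs v T).card = T.card :=
  Finset.card_image_of_injective _ fun _ _ h => Sym2.congr_right.1 h

lemma not_isDiag_of_mem_starPairs {v : Fin n} {T : Finset (Fin n)} (hv : v ∉ T) :
    ∀ e ∈ starPairs v T, ¬ e.IsDiag := by
  intro e he
  obtain ⟨w, hw, rfl⟩ := mem_starPairs.1 he
  rw [Sym2.mk_isDiag_iff]
  rintro rfl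
  exact hv hw

lemma eq_of_mem_starPairs_of_mem_starPairs {u v : Fin n} {T T' : Finset (Fin n)} (huv : u ≠ v)
    {e : Sym2 (Fin n)} (h : e ∈ starPairs u T) (h' : e ∈ starPairs v T') :
    v ∈ T ∧ u ∈ T' ∧ e = s(u, v) := by
  obtain ⟨w, hw, rfl⟩ := mem_starPairs.1 h
  obtain ⟨w', hw', heq⟩ := mem_starPairs.1 h'
  rw [Sym2.eq_iff] at heq
  rcases heq with ⟨h1, -⟩ | ⟨rfl, rfl⟩
  · exact absurd h1.symm huv
  · exact ⟨hw, hw', rfl⟩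

/-- The graphs in which the neighbourhood of `v` is `D` (where `v ∉ D`). -/
def neighborhoodEvent (x : Fin n × Finset (Fin n)) : Set (SimpleGraph (Fin n)) :=
  edgeCylinder (starPairs x.1 x.2) (starPairs x.1 (insert x.1 x.2)ᶜ)

lemma adj_iff_of_mem_neighborhoodEvent {v : Fin n} {D : Finset (Fin n)} {G : SimpleGraph (Fin n)}
    (hG : G ∈ neighborhoodEvent (v, D)) (w : Fin n) (hw : w ≠ v) : G.Adj v w ↔ w ∈ D := by
  constructor
  · intro h
    by_contra hwD
    exact hG.2 s(v, w) (mk_mem_starPairs.2 (by simp [hw, hwD])) h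
  · exact fun h => hG.1 s(v, w) (mk_mem_starPairs.2 h)

lemma disjoint_starPairs {v : Fin n} {T T' : Finset (Fin n)} (h : Disjoint T T') :
    Disjoint (starPairs v T) (starPairs v T') := by
  refine Finset.disjoint_left.2 fun e he he' => ?_
  obtain ⟨w, hw, rfl⟩ := mem_starPairs.1 he
  exact Finset.disjoint_left.1 h hw (mk_mem_starPairs.1 he')

lemma disjoint_compl_insert (v : Fin n) (D : Finset (Fin n)) : Disjoint D (insert v D)ᶜ :=
  Finset.disjoint_left.2 fun w hw hw' => by simp [hw] at hw'

lemma card_compl_insert {v : Fin n} {D : Finset (Fin n)} (hv : v ∉ D) :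
    ((insert v D)ᶜ).card = n - 1 - D.card := by
  rw [Finset.card_compl, Finset.card_insert_of_notMem hv, Fintype.card_fin]
  omega

lemma gnpProb_neighborhoodEvent {v : Fin n} {D : Finset (Fin n)} (hv : v ∉ D) :
    gnpProb n p (neighborhoodEvent (v, D)) = p ^ D.card * (1 - p) ^ (n - 1 - D.card) := by
  rw [neighborhoodEvent, gnpProb_edgeCylinder (not_isDiag_of_mem_starPairs hv)
    (not_isDiag_of_mem_starPairs (by simp)) (disjoint_starPairs (disjoint_compl_insert v D)),
    card_starPairs, card_starPairs, card_compl_insert hv]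

lemma gnpProb_empty : gnpProb n p ∅ = 0 := by simp [gnpProb_eq_sum_weight]

lemma edgeCylinder_inter (P Q P' Q' : Finset (Sym2 (Fin n))) :
    edgeCylinder P Q ∩ edgeCylinder P' Q' = edgeCylinder (P ∪ P') (Q ∪ Q') := by
  ext G
  simp only [Set.mem_inter_iff, mem_edgeCylinder, Finset.mem_union]
  constructor
  · rintro ⟨⟨h1, h2⟩, h3, h4⟩
    exact ⟨fun e he => he.elim (h1 e) (h3 e), fun e he => he.elim (h2 e) (h4 e)⟩
  · rintro ⟨h1, h2⟩
    exact ⟨⟨fun e he => h1 e (Or.inl he), fun e he => h2 e (Or.inl he)⟩,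
      fun e he => h1 e (Or.inr he), fun e he => h2 e (Or.inr he)⟩

lemma card_starPairs_union_add_one_ge {u v : Fin n} (huv : u ≠ v) (T T' : Finset (Fin n)) :
    T.card + T'.card ≤ (starPairs u T ∪ starPairs v T').card + 1 := by
  have h1 := Finset.card_union_add_card_inter (starPairs u T) (starPairs v T')
  have h2 : (starPairs u T ∩ starPairs v T').card ≤ 1 := by
    refine (Finset.card_le_card (t := {s(u, v)}) fun e he => ?_).trans_eq (Finset.card_singleton _)
    rw [Finset.mem_inter] at he
    rw [Finset.mem_singleton]
    exact (eq_of_mem_starPairs_of_mem_starPairs huv he.1 he.2).2.2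
  rw [card_starPairs, card_starPairs] at h1
  omega

lemma card_starPairs_union {u v : Fin n} (huv : u ≠ v) {T T' : Finset (Fin n)}
    (h : ¬ (v ∈ T ∧ u ∈ T')) :
    (starPairs u T ∪ starPairs v T').card = T.card + T'.card := by
  rw [Finset.card_union_of_disjoint, card_starPairs, card_starPairs]
  refine Finset.disjoint_left.2 fun e he he' => h ?_
  have := eq_of_mem_starPairs_of_mem_starPairs huv he he'
  exact ⟨this.1, this.2.1⟩

lemma gnpProb_neighborhoodEvent_inter_le (h0 : 0 < p) (h1 : p < 1) {d : ℕ}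
    {x y : Fin n × Finset (Fin n)} (hx : x.1 ∉ x.2) (hy : y.1 ∉ y.2) (hxd : x.2.card = d)
    (hyd : y.2.card = d) :
    gnpProb n p (neighborhoodEvent x ∩ neighborhoodEvent y) ≤
      (if x = y then p ^ d * (1 - p) ^ (n - 1 - d) else 0) +
      (p ^ d * (1 - p) ^ (n - 1 - d)) ^ 2 / (1 - p) +
      (if y.1 ∈ x.2 then (p ^ d * (1 - p) ^ (n - 1 - d)) ^ 2 / p else 0) := by
  have hq : 0 < 1 - p := by linarith
  have hempty : neighborhoodEvent x ∩ neighborhoodEvent y = ∅ →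
      gnpProb n p (neighborhoodEvent x ∩ neighborhoodEvent y) ≤
      (if x = y then p ^ d * (1 - p) ^ (n - 1 - d) else 0) +
      (p ^ d * (1 - p) ^ (n - 1 - d)) ^ 2 / (1 - p) +
      (if y.1 ∈ x.2 then (p ^ d * (1 - p) ^ (n - 1 - d)) ^ 2 / p else 0) := by
    intro h
    rw [h, gnpProb_empty]
    split_ifs <;> positivity
  obtain ⟨u, D⟩ := x
  obtain ⟨v, D'⟩ := y
  simp only at hx hy hxd hyd
  by_cases huv : u = v
  · subst huv
    by_cases hDD : D = D'
    · subst hDD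
      rw [Set.inter_self, gnpProb_neighborhoodEvent hx, hxd, if_pos rfl]
      have : 0 ≤ (p ^ d * (1 - p) ^ (n - 1 - d)) ^ 2 / (1 - p) := by positivity
      have : 0 ≤ (if (u, D).1 ∈ (u, D).2 then (p ^ d * (1 - p) ^ (n - 1 - d)) ^ 2 / p else 0) := by
        split_ifs <;> positivity
      linarith
    · refine hempty (Set.eq_empty_iff_forall_notMem.2 fun G hG => hDD ?_)
      ext w
      by_cases hw : w = u
      · subst hw; simp [hx, hy]
      · rw [← adj_iff_of_mem_neighborhoodEvent hG.1 w hw,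
          ← adj_iff_of_mem_neighborhoodEvent hG.2 w hw]
  · by_cases hiff : v ∈ D ↔ u ∈ D'
    · have hnd : ∀ (w : Fin n) (T : Finset (Fin n)), ∀ e ∈ starPairs w (insert w T)ᶜ,
          ¬ e.IsDiag := fun w T => not_isDiag_of_mem_starPairs (by simp)
      have hdisj : Disjoint (starPairs u D ∪ starPairs v D')
          (starPairs u (insert u D)ᶜ ∪ starPairs v (insert v D')ᶜ) := by
        rw [Finset.disjoint_union_left, Finset.disjoint_union_right, Finset.disjoint_union_right]
        refine ⟨⟨disjoint_starPairs (disjoint_compl_insert u D), ?_⟩, ?_,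
          disjoint_starPairs (disjoint_compl_insert v D')⟩
        · refine Finset.disjoint_left.2 fun e he he' => ?_
          have h := eq_of_mem_starPairs_of_mem_starPairs huv he he'
          have h2 := h.2.1
          simp [hiff.1 h.1] at h2
        · refine Finset.disjoint_left.2 fun e he he' => ?_
          have h := eq_of_mem_starPairs_of_mem_starPairs huv he' he
          have h2 := h.1
          simp [hiff.2 h.2.1] at h2
      have hprob : gnpProb n p (neighborhoodEvent (u, D) ∩ neighborhoodEvent (v, D')) =
          p ^ (starPairs u D ∪ starPairs v D').card *
          (1 - p) ^ (starPairs u (insert u D)ᶜ ∪ starPairs v (insert v D')ᶜ).card := by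
        rw [neighborhoodEvent, neighborhoodEvent, edgeCylinder_inter, gnpProb_edgeCylinder _ _ hdisj]
        · intro e he
          rcases Finset.mem_union.1 he with h | h
          exacts [not_isDiag_of_mem_starPairs hx e h, not_isDiag_of_mem_starPairs hy e h]
        · intro e he
          rcases Finset.mem_union.1 he with h | h
          exacts [hnd _ _ e h, hnd _ _ e h]
      have hne : (u, D) ≠ (v, D') := fun h => huv (congrArg Prod.fst h)
      rw [hprob, if_neg hne, zero_add]
      by_cases hvD : v ∈ D
      · rw [if_pos hvD]
        have hc1 := card_starPairs_union_add_one_ge huv D D'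
        have hc2 : (starPairs u (insert u D)ᶜ ∪ starPairs v (insert v D')ᶜ).card =
            (n - 1 - d) + (n - 1 - d) := by
          rw [card_starPairs_union huv (by simp [hvD]), card_compl_insert hx, card_compl_insert hy,
            hxd, hyd]
        have hp : p * p ^ (starPairs u D ∪ starPairs v D').card ≤ p ^ (d + d) := by
          rw [← pow_succ']
          exact pow_le_pow_of_le_one h0.le h1.le (by omega)
        have h3 : 0 ≤ (p ^ d * (1 - p) ^ (n - 1 - d)) ^ 2 / (1 - p) := by positivity
        refine le_trans ?_ (le_add_of_nonneg_left h3)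
        rw [le_div_iff₀ h0, hc2]
        calc _ = (p * p ^ (starPairs u D ∪ starPairs v D').card) *
              (1 - p) ^ ((n - 1 - d) + (n - 1 - d)) := by ring
          _ ≤ p ^ (d + d) * (1 - p) ^ ((n - 1 - d) + (n - 1 - d)) := by gcongr
          _ = _ := by rw [pow_add, pow_add]; ring
      · rw [if_neg hvD, add_zero]
        have hc1 := card_starPairs_union_add_one_ge huv (insert u D)ᶜ (insert v D')ᶜ
        have hc2 : (starPairs u D ∪ starPairs v D').card = d + d := by
          rw [card_starPairs_union huv (by simp [hvD]), hxd, hyd]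
        rw [card_compl_insert hx, card_compl_insert hy, hxd, hyd] at hc1
        have hp : (1 - p) * (1 - p) ^ (starPairs u (insert u D)ᶜ ∪
            starPairs v (insert v D')ᶜ).card ≤ (1 - p) ^ ((n - 1 - d) + (n - 1 - d)) := by
          rw [← pow_succ']
          exact pow_le_pow_of_le_one hq.le (by linarith) (by omega)
        rw [le_div_iff₀ hq, hc2]
        calc _ = p ^ (d + d) * ((1 - p) * (1 - p) ^ (starPairs u (insert u D)ᶜ ∪
              starPairs v (insert v D')ᶜ).card) := by ring
          _ ≤ p ^ (d + d) * (1 - p) ^ ((n - 1 - d) + (n - 1 - d)) := by gcongr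
          _ = _ := by rw [pow_add, pow_add]; ring
    · refine hempty (Set.eq_empty_iff_forall_notMem.2 fun G hG => hiff ?_)
      rw [← adj_iff_of_mem_neighborhoodEvent hG.1 v (Ne.symm huv),
        ← adj_iff_of_mem_neighborhoodEvent hG.2 u huv, G.adj_comm]

/-- The pairs of a vertex `v ∈ T` and a `d`-set of other vertices. -/
def pointedSets (T : Finset (Fin n)) (d : ℕ) : Finset (Fin n × Finset (Fin n)) :=
  (T ×ˢ Finset.univ).filter fun x => x.1 ∉ x.2 ∧ x.2.card = d

lemma mem_pointedSets {T : Finset (Fin n)} {d : ℕ} {x : Fin n × Finset (Fin n)} :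
    x ∈ pointedSets T d ↔ x.1 ∈ T ∧ x.1 ∉ x.2 ∧ x.2.card = d := by
  simp [pointedSets]

lemma card_pointedSets (T : Finset (Fin n)) (d : ℕ) :
    (pointedSets T d).card = T.card * (n - 1).choose d := by
  rw [pointedSets, Finset.card_filter, Finset.sum_product, ← smul_eq_mul, ← Finset.sum_const]
  refine Finset.sum_congr rfl fun v _ => ?_
  rw [← Finset.card_filter]
  have : Finset.univ.filter (fun D : Finset (Fin n) => v ∉ D ∧ D.card = d) =
      Finset.powersetCard d (Finset.univ.erase v) := by
    ext D
    simp [Finset.mem_powersetCard, Finset.subset_erase]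
  rw [this, Finset.card_powersetCard, Finset.card_erase_of_mem (Finset.mem_univ _),
    Finset.card_univ, Fintype.card_fin]

/-- A second moment bound for the probability that the connectivity exceeds `d`. -/
lemma gnpProb_lt_vertexConnectivity_le {d : ℕ} (h0 : 0 < p) (h1 : p < 1) (hn : d + 1 < n) :
    gnpProb n p {G | d < vertexConnectivity G} ≤
      1 / (n * (n - 1).choose d * (p ^ d * (1 - p) ^ (n - 1 - d))) + (1 / (1 - p) - 1) +
        d / (n * p) := by
  have hq : 0 < 1 - p := by linarith
  have hn0 : (0 : ℝ) < n := by exact_mod_cast (by omega : 0 < n)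
  set β := p ^ d * (1 - p) ^ (n - 1 - d) with hβ
  have hβ0 : 0 < β := by positivity
  set I := pointedSets (Finset.univ : Finset (Fin n)) d with hI
  have hIcard : (I.card : ℝ) = n * (n - 1).choose d := by
    rw [hI, card_pointedSets, Finset.card_univ, Fintype.card_fin]; push_cast; rfl
  have hchoose : (0 : ℝ) < (n - 1).choose d := by
    exact_mod_cast Nat.choose_pos (by omega : d ≤ n - 1)
  have hIpos : (0 : ℝ) < I.card := by rw [hIcard]; positivity
  have hIx : ∀ x ∈ I, x.1 ∉ x.2 ∧ x.2.card = d := fun x hx => (mem_pointedSets.1 hx).2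
  set X : SimpleGraph (Fin n) → ℝ := fun G => ∑ x ∈ I, if G ∈ neighborhoodEvent x then 1 else 0
    with hX
  have hind : ∀ A : Set (SimpleGraph (Fin n)),
      ∑ G, gnpWeight n p G * (if G ∈ A then 1 else 0) = gnpProb n p A := by
    intro A
    simp [gnpProb_eq_sum_weight, Finset.sum_filter]
  have hEX : ∑ G, gnpWeight n p G * X G = I.card * β := by
    simp only [hX, Finset.mul_sum]
    rw [Finset.sum_comm]
    calc _ = ∑ x ∈ I, β := by
          refine Finset.sum_congr rfl fun x hx => ?_
          rw [hind, gnpProb_neighborhoodEvent (hIx x hx).1, (hIx x hx).2]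
      _ = _ := by rw [Finset.sum_const, nsmul_eq_mul]
  have hsq : ∀ G, X G ^ 2 = ∑ x ∈ I, ∑ y ∈ I,
      if G ∈ neighborhoodEvent x ∩ neighborhoodEvent y then 1 else 0 := by
    intro G
    rw [sq, Finset.sum_mul_sum]
    refine Finset.sum_congr rfl fun x _ => Finset.sum_congr rfl fun y _ => ?_
    by_cases hx : G ∈ neighborhoodEvent x <;> by_cases hy : G ∈ neighborhoodEvent y <;>
      simp [hx, hy]
  have hEX2 : ∑ G, gnpWeight n p G * X G ^ 2 ≤
      I.card * β + (I.card * β) ^ 2 / (1 - p) + (I.card * β) ^ 2 * (d / (n * p)) := by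
    calc ∑ G, gnpWeight n p G * X G ^ 2
        = ∑ x ∈ I, ∑ y ∈ I, gnpProb n p (neighborhoodEvent x ∩ neighborhoodEvent y) := by
          simp only [← hind, hsq, Finset.mul_sum]
          rw [Finset.sum_comm]
          exact Finset.sum_congr rfl fun x _ => by
            rw [Finset.sum_comm]
            congr!
      _ ≤ ∑ x ∈ I, ∑ y ∈ I, ((if x = y then β else 0) + β ^ 2 / (1 - p) +
            (if y.1 ∈ x.2 then β ^ 2 / p else 0)) := by
          refine Finset.sum_le_sum fun x hx => Finset.sum_le_sum fun y hy => ?_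
          exact gnpProb_neighborhoodEvent_inter_le h0 h1 (hIx x hx).1 (hIx y hy).1 (hIx x hx).2
            (hIx y hy).2
      _ = ∑ x ∈ I, (β + I.card * (β ^ 2 / (1 - p)) + d * (n - 1).choose d * (β ^ 2 / p)) := by
          refine Finset.sum_congr rfl fun x hx => ?_
          rw [Finset.sum_add_distrib, Finset.sum_add_distrib, Finset.sum_ite_eq, if_pos hx,
            Finset.sum_const, nsmul_eq_mul, ← Finset.sum_filter, Finset.sum_const, nsmul_eq_mul]
          have : I.filter (fun y => y.1 ∈ x.2) = pointedSets x.2 d := by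
            ext y
            simp only [Finset.mem_filter, hI, mem_pointedSets, Finset.mem_univ, true_and]
            tauto
          rw [this, card_pointedSets x.2, (hIx x hx).2, Nat.cast_mul]
      _ = _ := by
          rw [Finset.sum_const, nsmul_eq_mul]
          have : ((n - 1).choose d : ℝ) = I.card / n := by rw [hIcard]; field_simp
          rw [this]
          clear_value β
          generalize (I.card : ℝ) = M
          field_simp
  have hcheb := gnpProb_eq_zero_mul_sq_le h0.le h1.le X
  rw [hEX] at hcheb
  have hsub : gnpProb n p {G | d < vertexConnectivity G} ≤ gnpProb n p {G | X G = 0} := by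
    refine gnpProb_mono h0.le h1.le fun G hG => ?_
    refine Finset.sum_eq_zero fun x hx => if_neg fun hGx => ?_
    refine absurd (vertexConnectivity_le_of_neighborSet_subset (k := d) G x.1 x.2 (hIx x hx).1
      (hIx x hx).2.le hn fun w hw => ?_) (not_le.2 hG)
    exact (adj_iff_of_mem_neighborhoodEvent hGx w hw.ne').1 hw
  refine hsub.trans ?_
  rw [← hIcard]
  have hμ : 0 < I.card * β := by positivity
  have hμ2 : 0 < (I.card * β) ^ 2 := by positivity
  refine le_of_mul_le_mul_right (hcheb.trans ?_) hμ2
  have : (1 / (I.card * β) + (1 / (1 - p) - 1) + d / (n * p)) * (I.card * β) ^ 2 =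
    I.card * β + (I.card * β) ^ 2 / (1 - p) + (I.card * β) ^ 2 * (d / (n * p)) -
      (I.card * β) ^ 2 := by
    field_simp
    ring
  rw [this]
  linarith

lemma gnpProb_union_le (h0 : 0 ≤ p) (h1 : p ≤ 1) (A B : Set (SimpleGraph (Fin n))) :
    gnpProb n p (A ∪ B) ≤ gnpProb n p A + gnpProb n p B := by
  have h := gnpProb_iUnion_le h0 h1 (Finset.univ : Finset Bool) (fun b => cond b A B)
  rw [Fintype.sum_bool] at h
  refine le_trans (gnpProb_mono h0 h1 fun G hG => ?_) h
  rcases hG with hG | hG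
  exacts [⟨true, Finset.mem_univ _, hG⟩, ⟨false, Finset.mem_univ _, hG⟩]

lemma gnpProb_le_one (h0 : 0 ≤ p) (h1 : p ≤ 1) (A : Set (SimpleGraph (Fin n))) :
    gnpProb n p A ≤ 1 := by
  rw [← gnpProb_univ (n := n) (p := p)]
  exact gnpProb_mono h0 h1 (Set.subset_univ A)

lemma exp_le_one_sub_pow (h2 : p ≤ 1 / 2) (hp2 : 2 * n * p ^ 2 ≤ 1) :
    Real.exp (-(p * n)) * Real.exp (-1) ≤ (1 - p) ^ n := by
  have hq : 0 < 1 - p := by linarith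
  have hlog := Real.one_sub_inv_le_log_of_pos hq
  have hinv : (1 - p)⁻¹ ≤ 1 + p + 2 * p ^ 2 := by
    rw [inv_le_iff_one_le_mul₀ hq]
    nlinarith [mul_nonneg (sq_nonneg p) (by linarith : 0 ≤ 1 - 2 * p)]
  rw [← Real.exp_add, ← Real.exp_log (pow_pos hq n), Real.log_pow]
  apply Real.exp_le_exp.2
  have hn : (0 : ℝ) ≤ n := Nat.cast_nonneg n
  nlinarith

lemma le_expected_card_degree_eq {d : ℕ} {L M : ℝ} (h0 : 0 ≤ p) (h2 : p ≤ 1 / 2)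
    (hp2 : 2 * n * p ^ 2 ≤ 1) (hL : 0 ≤ L) (hLp : L ≤ n * p)
    (hM : n * Real.exp (-(p * n)) * L ^ d = M) (hd : 2 * d ≤ n) :
    M / (2 ^ d * d.factorial * Real.exp 1) ≤
      n * (n - 1).choose d * (p ^ d * (1 - p) ^ (n - 1 - d)) := by
  have hq : 0 ≤ 1 - p := by linarith
  have hchoose : ((n : ℝ) / 2) ^ d / d.factorial ≤ (n - 1).choose d := by
    refine le_trans ?_ (Nat.pow_le_choose d (n - 1))
    gcongr
    rw [div_le_iff₀ (by norm_num)]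
    rcases Nat.eq_zero_or_pos n with rfl | hn
    · simp
    · have : n ≤ (n - 1 + 1 - d) * 2 := by omega
      exact_mod_cast this
  have hpow : Real.exp (-(p * n)) * Real.exp (-1) ≤ (1 - p) ^ (n - 1 - d) :=
    (exp_le_one_sub_pow h2 hp2).trans (pow_le_pow_of_le_one hq (by linarith) (by omega))
  calc M / (2 ^ d * d.factorial * Real.exp 1)
      = n * (1 / 2 ^ d / d.factorial) * (L ^ d * (Real.exp (-(p * n)) * Real.exp (-1))) := by
        rw [← hM, Real.exp_neg 1]
        field_simp
    _ ≤ n * (1 / 2 ^ d / d.factorial) * ((n * p) ^ d * (1 - p) ^ (n - 1 - d)) := by gcongr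
    _ = n * (((n : ℝ) / 2) ^ d / d.factorial) * (p ^ d * (1 - p) ^ (n - 1 - d)) := by
        rw [mul_pow, div_pow]; field_simp
    _ ≤ _ := by gcongr

end RandomGraph

section Asymptotics

lemma tendsto_log_natCast_atTop : Tendsto (fun n : ℕ => Real.log n) atTop atTop :=
  Real.tendsto_log_atTop.comp tendsto_natCast_atTop_atTop

lemma tendsto_log_sq_div_natCast :
    Tendsto (fun n : ℕ => Real.log n ^ 2 / n) atTop (nhds 0) := by
  have h := (Real.isLittleO_pow_log_id_atTop (n := 2)).tendsto_div_nhds_zero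
  exact h.comp tendsto_natCast_atTop_atTop

lemma eventually_mul_log_le (c : ℝ) : ∀ᶠ x : ℝ in atTop, c * Real.log x ≤ x := by
  have h := (Real.isLittleO_log_id_atTop.const_mul_left c).bound one_pos
  filter_upwards [h, eventually_ge_atTop 0] with x hx hx0
  have := (le_abs_self _).trans hx
  simpa [abs_of_nonneg hx0] using this

/-- Bounds on `p(n) = (log n + (k+1) log log n − log log log n)/n` for large `n`. -/
lemma eventually_edgeProbability_bounds (k : ℕ) {p : ℕ → ℝ}
    (hp : ∀ n : ℕ, p n = (Real.log n + ((k : ℝ) + 1) * Real.log (Real.log n) -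
      Real.log (Real.log (Real.log n))) / n) :
    ∀ᶠ n : ℕ in atTop, Real.log n ≤ n * p n ∧ n * p n ≤ 2 * Real.log n ∧
      n * Real.exp (-(p n * n)) * Real.log n ^ (k + 1) = Real.log (Real.log n) := by
  have hL := tendsto_log_natCast_atTop
  have hM := Real.tendsto_log_atTop.comp hL
  have hN := Real.tendsto_log_atTop.comp hM
  filter_upwards [hL.eventually (eventually_mul_log_le ((k : ℝ) + 1)),
    hL.eventually_gt_atTop 0, hM.eventually_gt_atTop 0, hN.eventually_ge_atTop 0,
    eventually_gt_atTop 0] with n h1 hL0 hM0 hN0 hn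
  simp only [Function.comp_apply] at hM0 hN0
  have hn0 : (0 : ℝ) < n := by exact_mod_cast hn
  have hnp : n * p n = Real.log n + ((k : ℝ) + 1) * Real.log (Real.log n) -
      Real.log (Real.log (Real.log n)) := by
    rw [hp]; field_simp
  have hNM : Real.log (Real.log (Real.log n)) ≤ Real.log (Real.log n) :=
    (Real.log_le_sub_one_of_pos hM0).trans (by linarith)
  have hkM : 0 ≤ (k : ℝ) * Real.log (Real.log n) := by positivity
  refine ⟨by rw [hnp]; linarith, by rw [hnp]; linarith, ?_⟩
  have hexp : -(p n * n) = -Real.log n + (-((k + 1 : ℕ) * Real.log (Real.log n)) +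
      Real.log (Real.log (Real.log n))) := by
    rw [mul_comm, hnp]; push_cast; ring
  rw [hexp, Real.exp_add, Real.exp_add, Real.exp_neg, Real.exp_neg, Real.exp_log hn0,
    Real.exp_nat_mul, Real.exp_log hL0, Real.exp_log hM0]
  field_simp

end Asymptotics

/-- Almost surely `k ≤ κ(G(n, p(n))) ≤ k + 1` for
`p(n) = (log n + (k+1) log log n − log log log n)/n`. -/
theorem vertexConnectivity_bounds_as (k : ℕ) (hk : 1 ≤ k) :
    Tendsto (fun n : ℕ =>
      gnpProb n ((Real.log n + ((k : ℝ) + 1) * Real.log (Real.log n) -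
          Real.log (Real.log (Real.log n))) / n)
        {G : SimpleGraph (Fin n) |
          k ≤ vertexConnectivity G ∧ vertexConnectivity G ≤ k + 1})
      atTop (nhds 1) := by
  obtain ⟨p, hp⟩ : ∃ p : ℕ → ℝ, ∀ n : ℕ, p n = (Real.log n + ((k : ℝ) + 1) *
    Real.log (Real.log n) - Real.log (Real.log (Real.log n))) / n := ⟨_, fun _ => rfl⟩
  simp only [← hp]
  have hL := tendsto_log_natCast_atTop
  have hM := Real.tendsto_log_atTop.comp hL
  have hbounds := eventually_edgeProbability_bounds k hp
  have hsq0 := tendsto_log_sq_div_natCast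
  have hp0 : ∀ᶠ n : ℕ in atTop, 0 < p n := by
    filter_upwards [hbounds, hL.eventually_gt_atTop 0, eventually_gt_atTop 0] with n h hLn hn
    have hn0 : (0 : ℝ) < n := by exact_mod_cast hn
    exact pos_of_mul_pos_right (hLn.trans_le h.1) hn0.le
  have hpsq : ∀ᶠ n : ℕ in atTop, n * p n ^ 2 ≤ 4 * (Real.log n ^ 2 / n) ∧
      p n ≤ 2 * (Real.log n ^ 2 / n) := by
    filter_upwards [hbounds, hp0, hL.eventually_ge_atTop 1, eventually_gt_atTop 0]
      with n h hpn hLn hn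
    have hn0 : (0 : ℝ) < n := by exact_mod_cast hn
    rw [mul_div_assoc', mul_div_assoc', le_div_iff₀ hn0, le_div_iff₀ hn0]
    constructor
    · nlinarith [pow_le_pow_left₀ (by positivity) h.2.1 2]
    · nlinarith [h.2.1]
  have hptend : Tendsto p atTop (nhds 0) := by
    have h2 := hsq0.const_mul 2
    rw [mul_zero] at h2
    exact tendsto_of_tendsto_of_tendsto_of_le_of_le' tendsto_const_nhds h2
      (hp0.mono fun n h => h.le) (hpsq.mono fun n h => h.2)
  set c : ℝ := 2 ^ (k + 1) * (k + 1).factorial * Real.exp 1 with hc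
  have hc0 : 0 < c := by positivity
  have hlower : ∀ᶠ n : ℕ in atTop,
      1 - ((k * (2 * (4 ^ k * Real.exp 10 / Real.log n)) + Real.exp (-n)) +
        (c / Real.log (Real.log n) + (1 / (1 - p n) - 1) + ((k + 1 : ℕ) : ℝ) / Real.log n)) ≤
      gnpProb n (p n) {G : SimpleGraph (Fin n) |
          k ≤ vertexConnectivity G ∧ vertexConnectivity G ≤ k + 1} := by
    have hpk : ∀ᶠ n : ℕ in atTop, p n * k ≤ 1 := by
      have h := hptend.mul_const (k : ℝ)
      rw [zero_mul] at h
      exact h.eventually_le_const one_pos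
    have hKL : ∀ᶠ n : ℕ in atTop, 4 ^ k * Real.exp 10 / Real.log n ≤ 1 / 2 :=
      (hL.const_div_atTop (4 ^ k * Real.exp 10)).eventually_le_const (by norm_num)
    filter_upwards [hbounds, hp0, hpsq, hL.eventually_ge_atTop 1, hM.eventually_gt_atTop 0,
      eventually_gt_atTop (3 * k + 5), hpk, hKL,
      hptend.eventually_le_const (by norm_num : (0 : ℝ) < 1 / 2),
      hsq0.eventually_le_const (by norm_num : (0 : ℝ) < 1 / 8)]
      with n hb hpn hsqn hLn hMn hn hpkn hKLn hp2 hsmall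
    simp only [Function.comp_apply] at hMn
    have hL0 : 0 < Real.log n := by linarith
    have hn0 : (0 : ℝ) < n := by exact_mod_cast (by omega : 0 < n)
    have hML : Real.log (Real.log n) ≤ Real.log n :=
      (Real.log_le_sub_one_of_pos hL0).trans (by linarith)
    have hexp : n * Real.exp (-(p n * n)) * Real.log n ^ k ≤ 1 := by
      refine le_of_mul_le_mul_right ?_ hL0
      rw [mul_assoc, ← pow_succ, hb.2.2, one_mul]
      exact hML
    have hlt := gnpProb_vertexConnectivity_lt_le hpn.le (by linarith) hLn hb.2.1 hexp hpkn
      (by omega) hKLn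
    have hgt := gnpProb_lt_vertexConnectivity_le (d := k + 1) hpn (by linarith)
      (by omega : k + 1 + 1 < n)
    have hμ := le_expected_card_degree_eq (d := k + 1) hpn.le hp2 (by linarith [hsqn.1]) hL0.le
      hb.1 hb.2.2 (by omega)
    rw [← hc] at hμ
    have hμ1 := one_div_le_one_div_of_le (by positivity) hμ
    rw [one_div_div] at hμ1
    have hdiv : ((k + 1 : ℕ) : ℝ) / (n * p n) ≤ ((k + 1 : ℕ) : ℝ) / Real.log n :=
      div_le_div_of_nonneg_left (by positivity) hL0 hb.1
    have hcompl := gnpProb_compl (n := n) (p := p n) {G : SimpleGraph (Fin n) |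
      k ≤ vertexConnectivity G ∧ vertexConnectivity G ≤ k + 1}
    have hunion : gnpProb n (p n) {G : SimpleGraph (Fin n) |
        k ≤ vertexConnectivity G ∧ vertexConnectivity G ≤ k + 1}ᶜ ≤
        gnpProb n (p n) {G | vertexConnectivity G < k} +
        gnpProb n (p n) {G | k + 1 < vertexConnectivity G} := by
      refine (gnpProb_mono hpn.le (by linarith) fun G hG => ?_).trans
        (gnpProb_union_le hpn.le (by linarith) _ _)
      by_contra hnot
      refine hG ⟨not_lt.1 fun h => hnot (Or.inl h), not_lt.1 fun h => hnot (Or.inr h)⟩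
    linarith
  refine tendsto_of_tendsto_of_tendsto_of_le_of_le' ?_ tendsto_const_nhds hlower ?_
  · have e1 : Tendsto (fun n : ℕ => (k : ℝ) * (2 * (4 ^ k * Real.exp 10 / Real.log n))) atTop
        (nhds 0) := by
      simpa using ((hL.const_div_atTop (4 ^ k * Real.exp 10)).const_mul 2).const_mul (k : ℝ)
    have e2 : Tendsto (fun n : ℕ => Real.exp (-(n : ℝ))) atTop (nhds 0) :=
      Real.tendsto_exp_neg_atTop_nhds_zero.comp tendsto_natCast_atTop_atTop
    have e3 : Tendsto (fun n : ℕ => c / Real.log (Real.log n)) atTop (nhds 0) :=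
      hM.const_div_atTop c
    have e4 : Tendsto (fun n : ℕ => 1 / (1 - p n) - 1) atTop (nhds 0) := by
      have h : Tendsto (fun n : ℕ => 1 / (1 - p n) - 1) atTop (nhds (1 / (1 - 0) - 1)) :=
        ((tendsto_const_nhds.div (tendsto_const_nhds.sub hptend) (by norm_num)).sub_const 1)
      simpa using h
    have e5 : Tendsto (fun n : ℕ => ((k + 1 : ℕ) : ℝ) / Real.log n) atTop (nhds 0) :=
      hL.const_div_atTop _
    simpa using ((e1.add e2).add ((e3.add e4).add e5)).const_sub 1
  · filter_upwards [hp0, hptend.eventually_le_const one_pos] with n h0 h1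
    exact gnpProb_le_one h0.le h1 _
end

section
/- Let k ≥ 1 be a fixed integer, p(n) = (log n + (k+1)·log log n − log log log n)/n and D = log n / log log n. Then almost surely G(n, p(n)) does not contain two distinct vertices x and y, both of degree less than (log n)/100, whose distance in the graph is at most (3/4)·D; indeed, for all sufficiently large n the probability that such a pair exists is at most n^{−9/100}. -/
open Filter Asymptotics
open scoped Classical

/-- The Bernoulli weight of the graphs containing a set `P` of edges, tilted by a factor `t` for
each edge in a set `S` disjoint from `P`. -/
lemma sum_gnp_weight_tilted_le {n : ℕ} {p t : ℝ} (hp₀ : 0 ≤ p) (hp₁ : p ≤ 1) (ht : 0 ≤ t)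
    {P S : Finset (Sym2 (Fin n))} (hP : P ⊆ (⊤ : SimpleGraph (Fin n)).edgeFinset)
    (hS : S ⊆ (⊤ : SimpleGraph (Fin n)).edgeFinset) (hPS : Disjoint P S) :
    ∑ G : SimpleGraph (Fin n) with P ⊆ G.edgeFinset,
      p ^ edgeCount G * (1 - p) ^ (n.choose 2 - edgeCount G) * t ^ (G.edgeFinset ∩ S).card ≤
      p ^ P.card * (1 - p + p * t) ^ S.card := by
  have hq : 0 ≤ 1 - p := sub_nonneg.2 hp₁
  set E := (⊤ : SimpleGraph (Fin n)).edgeFinset with hE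
  let f : Sym2 (Fin n) → ℝ := fun e => p * if e ∈ S then t else 1
  let g : Sym2 (Fin n) → ℝ := fun e => if e ∈ P then 0 else 1 - p
  have hf : ∀ e, 0 ≤ f e := fun e => by dsimp only [f]; split_ifs <;> positivity
  have hg : ∀ e, 0 ≤ g e := fun e => by dsimp only [g]; split_ifs <;> simp [hq]
  have hcard : E.card = n.choose 2 := by
    rw [hE, SimpleGraph.card_edgeFinset_top_eq_card_choose_two, Fintype.card_fin]
  have hsub : ∀ G : SimpleGraph (Fin n), G.edgeFinset ⊆ E := fun G =>
    SimpleGraph.edgeFinset_mono le_top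
  have key : ∏ e ∈ E, (f e + g e) = p ^ P.card * (1 - p + p * t) ^ S.card := by
    have hsplit : E = (P ∪ S) ∪ (E \ (P ∪ S)) := by
      rw [Finset.union_sdiff_of_subset (Finset.union_subset hP hS)]
    rw [hsplit, Finset.prod_union Finset.disjoint_sdiff, Finset.prod_union hPS]
    have h₁ : ∏ e ∈ P, (f e + g e) = p ^ P.card := by
      rw [← Finset.prod_const]
      refine Finset.prod_congr rfl fun e he => ?_
      simp [f, g, he, Finset.disjoint_left.1 hPS he]
    have h₂ : ∏ e ∈ S, (f e + g e) = (1 - p + p * t) ^ S.card := by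
      rw [← Finset.prod_const]
      refine Finset.prod_congr rfl fun e he => ?_
      simp [f, g, he, Finset.disjoint_right.1 hPS he]
      ring
    have h₃ : ∏ e ∈ E \ (P ∪ S), (f e + g e) = 1 := by
      refine Finset.prod_eq_one fun e he => ?_
      simp only [Finset.mem_sdiff, Finset.mem_union, not_or] at he
      simp [f, g, he.2.1, he.2.2]
    rw [h₁, h₂, h₃, mul_one]
  rw [← key, Finset.prod_add]
  have hterm : ∀ G ∈ Finset.univ.filter (fun G : SimpleGraph (Fin n) => P ⊆ G.edgeFinset),
      p ^ edgeCount G * (1 - p) ^ (n.choose 2 - edgeCount G) * t ^ (G.edgeFinset ∩ S).card =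
        (∏ e ∈ G.edgeFinset, f e) * ∏ e ∈ E \ G.edgeFinset, g e := by
    intro G hG
    have hPG := (Finset.mem_filter.1 hG).2
    have h₁ : ∏ e ∈ G.edgeFinset, f e = p ^ edgeCount G * t ^ (G.edgeFinset ∩ S).card := by
      dsimp only [f]
      rw [Finset.prod_mul_distrib, Finset.prod_const, Finset.prod_ite_mem, Finset.prod_const]
      rfl
    have h₂ : ∏ e ∈ E \ G.edgeFinset, g e = (1 - p) ^ (n.choose 2 - edgeCount G) := by
      rw [← hcard, edgeCount, ← Finset.card_sdiff_of_subset (hsub G), ← Finset.prod_const]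
      refine Finset.prod_congr rfl fun e he => ?_
      have : e ∉ P := fun h => (Finset.mem_sdiff.1 he).2 (hPG h)
      simp [g, this]
    rw [h₁, h₂]
    ring
  rw [Finset.sum_congr rfl hterm]
  have hinj : Function.Injective (fun G : SimpleGraph (Fin n) => G.edgeFinset) :=
    fun G H h => SimpleGraph.edgeFinset_inj.1 h
  rw [← Finset.sum_image (f := fun T : Finset (Sym2 (Fin n)) =>
    (∏ e ∈ T, f e) * ∏ e ∈ E \ T, g e) (g := fun G : SimpleGraph (Fin n) => G.edgeFinset)
    hinj.injOn]
  refine Finset.sum_le_sum_of_subset_of_nonneg ?_ fun T _ _ =>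
    mul_nonneg (Finset.prod_nonneg fun e _ => hf e) (Finset.prod_nonneg fun e _ => hg e)
  intro T hT
  obtain ⟨G, -, rfl⟩ := Finset.mem_image.1 hT
  exact Finset.mem_powerset.2 (hsub G)

/-- The edges of the path visiting the vertices `v 0, …, v l` in this order. -/
def pathEdges {n l : ℕ} (v : Fin (l + 1) → Fin n) : Finset (Sym2 (Fin n)) :=
  Finset.univ.image fun i : Fin l => s(v i.castSucc, v i.succ)

/-- The pairs joining `x` to a vertex outside the range of `v`. -/
def starEdges {n l : ℕ} (v : Fin (l + 1) → Fin n) (x : Fin n) : Finset (Sym2 (Fin n)) :=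
  (Finset.univ.filter fun w => ∀ i, v i ≠ w).image fun w => s(x, w)

section

variable {n l : ℕ} {v : Fin (l + 1) → Fin n}

lemma card_pathEdges (hv : Function.Injective v) : (pathEdges v).card = l := by
  rw [pathEdges, Finset.card_image_of_injective, Finset.card_univ, Fintype.card_fin]
  intro i j hij
  simp only [Sym2.eq_iff, hv.eq_iff, Fin.ext_iff, Fin.val_castSucc, Fin.val_succ] at hij
  ext
  omega

lemma pathEdges_subset_top (hv : Function.Injective v) :
    pathEdges v ⊆ (⊤ : SimpleGraph (Fin n)).edgeFinset := by
  intro e he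
  obtain ⟨i, -, rfl⟩ := Finset.mem_image.1 he
  simp [hv.eq_iff, Fin.ext_iff]

lemma card_starEdges (hv : Function.Injective v) (x : Fin n) :
    (starEdges v x).card = n - (l + 1) := by
  rw [starEdges, Finset.card_image_of_injective _ (fun a b h => Sym2.congr_right.1 h)]
  have : (Finset.univ.filter fun w => ∀ i, v i ≠ w) = (Finset.univ.image v)ᶜ := by
    ext w
    simp
  rw [this, Finset.card_compl, Finset.card_image_of_injective _ hv]
  simp

lemma starEdges_subset_top (i : Fin (l + 1)) :
    starEdges v (v i) ⊆ (⊤ : SimpleGraph (Fin n)).edgeFinset := by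
  intro e he
  obtain ⟨w, hw, rfl⟩ := Finset.mem_image.1 he
  simpa using (Finset.mem_filter.1 hw).2 i

lemma disjoint_pathEdges_starEdges (x : Fin n) : Disjoint (pathEdges v) (starEdges v x) := by
  rw [Finset.disjoint_left]
  intro e he he'
  obtain ⟨i, -, rfl⟩ := Finset.mem_image.1 he
  obtain ⟨w, hw, h⟩ := Finset.mem_image.1 he'
  have hw := (Finset.mem_filter.1 hw).2
  rw [Sym2.eq_iff] at h
  rcases h with h | h
  · exact hw _ h.2.symm
  · exact hw _ h.2.symm

lemma disjoint_starEdges {i j : Fin (l + 1)} (h : v i ≠ v j) :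
    Disjoint (starEdges v (v i)) (starEdges v (v j)) := by
  rw [Finset.disjoint_left]
  intro e he he'
  obtain ⟨a, ha, rfl⟩ := Finset.mem_image.1 he
  obtain ⟨b, hb, hab⟩ := Finset.mem_image.1 he'
  have hb := (Finset.mem_filter.1 hb).2
  rw [Sym2.eq_iff] at hab
  rcases hab with hab | hab
  · exact h hab.1.symm
  · exact hb i hab.2.symm

lemma card_edgeFinset_inter_starEdges_le (G : SimpleGraph (Fin n)) (x : Fin n) :
    (G.edgeFinset ∩ starEdges v x).card ≤ G.degree x := by
  rw [← SimpleGraph.card_incidenceFinset_eq_degree]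
  refine Finset.card_le_card fun e he => ?_
  obtain ⟨he, he'⟩ := Finset.mem_inter.1 he
  obtain ⟨w, -, rfl⟩ := Finset.mem_image.1 he'
  rw [SimpleGraph.mem_incidenceFinset]
  exact ⟨SimpleGraph.mem_edgeFinset.1 he, Sym2.mem_mk_left x w⟩

end

/-- The probability that a prescribed path is present and that the sum of the degrees of its two
ends is less than `b`. -/
lemma gnpProb_path_le {n l : ℕ} {p t b : ℝ} (hp₀ : 0 ≤ p) (hp₁ : p ≤ 1) (ht₀ : 0 < t)
    (ht₁ : t ≤ 1) (hl : 1 ≤ l) {v : Fin (l + 1) → Fin n} (hv : Function.Injective v) :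
    gnpProb n p {G | pathEdges v ⊆ G.edgeFinset ∧
      (G.degree (v 0) : ℝ) + G.degree (v (Fin.last l)) < b} ≤
      t ^ (-b) * (p ^ l * (1 - p + p * t) ^ (2 * (n - (l + 1)))) := by
  have hxy : v 0 ≠ v (Fin.last l) := by
    rw [Ne, hv.eq_iff, Fin.ext_iff, Fin.val_zero, Fin.val_last]
    omega
  have hq : 0 ≤ 1 - p := sub_nonneg.2 hp₁
  set S := starEdges v (v 0) ∪ starEdges v (v (Fin.last l)) with hS
  have hcard : S.card = 2 * (n - (l + 1)) := by
    rw [hS, Finset.card_union_of_disjoint (disjoint_starEdges hxy), card_starEdges hv,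
      card_starEdges hv]
    ring
  have htilt := sum_gnp_weight_tilted_le hp₀ hp₁ ht₀.le (pathEdges_subset_top hv)
    (Finset.union_subset (starEdges_subset_top (v := v) 0) (starEdges_subset_top (Fin.last l)))
    (Finset.disjoint_union_right.2
      ⟨disjoint_pathEdges_starEdges (v 0), disjoint_pathEdges_starEdges (v (Fin.last l))⟩)
  rw [← hS, hcard, card_pathEdges hv] at htilt
  refine le_trans ?_ (mul_le_mul_of_nonneg_left htilt (Real.rpow_nonneg ht₀.le _))
  simp only [gnpProb, Finset.sum_filter, Finset.mul_sum]
  refine Finset.sum_le_sum fun G _ => ?_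
  split_ifs with hG hG' hG'
  rotate_left
  · exact absurd hG.1 hG'
  · positivity
  · simp
  have hdeg := hG.2
  have hle : ((G.edgeFinset ∩ S).card : ℝ) ≤ b := by
    refine le_trans ?_ hdeg.le
    rw [hS, Finset.inter_union_distrib_left]
    exact_mod_cast (Finset.card_union_le _ _).trans
      (add_le_add (card_edgeFinset_inter_starEdges_le G _)
        (card_edgeFinset_inter_starEdges_le G _))
  have hone : 1 ≤ t ^ (-b) * t ^ (G.edgeFinset ∩ S).card := by
    rw [← Real.rpow_natCast, ← Real.rpow_add ht₀]
    exact Real.one_le_rpow_of_pos_of_le_one_of_nonpos ht₀ ht₁ (by linarith)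
  calc p ^ edgeCount G * (1 - p) ^ (n.choose 2 - edgeCount G)
      ≤ p ^ edgeCount G * (1 - p) ^ (n.choose 2 - edgeCount G) *
        (t ^ (-b) * t ^ (G.edgeFinset ∩ S).card) := le_mul_of_one_le_right (by positivity) hone
    _ = _ := by ring

lemma gnpProb_nonneg {n : ℕ} {p : ℝ} (hp₀ : 0 ≤ p) (hp₁ : p ≤ 1)
    (A : Set (SimpleGraph (Fin n))) : 0 ≤ gnpProb n p A := by
  have hq : 0 ≤ 1 - p := sub_nonneg.2 hp₁
  exact Finset.sum_nonneg fun G _ => by positivity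

lemma gnpProb_le_sum {n : ℕ} {p : ℝ} (hp₀ : 0 ≤ p) (hp₁ : p ≤ 1)
    {ι : Type*} (s : Finset ι) (B : ι → Set (SimpleGraph (Fin n)))
    {A : Set (SimpleGraph (Fin n))} (hA : ∀ G ∈ A, ∃ i ∈ s, G ∈ B i) :
    gnpProb n p A ≤ ∑ i ∈ s, gnpProb n p (B i) := by
  have hq : 0 ≤ 1 - p := sub_nonneg.2 hp₁
  simp only [gnpProb, Finset.sum_filter]
  rw [Finset.sum_comm]
  refine Finset.sum_le_sum fun G _ => ?_
  have hterm : ∀ i ∈ s, 0 ≤ if G ∈ B i then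
      p ^ edgeCount G * (1 - p) ^ (n.choose 2 - edgeCount G) else 0 := fun i _ => by
    split_ifs <;> positivity
  split_ifs with h
  · obtain ⟨i, hi, hGi⟩ := hA G h
    refine le_trans ?_ (Finset.single_le_sum hterm hi)
    rw [if_pos hGi]
  · exact Finset.sum_nonneg hterm

/-- A first moment bound for pairs of vertices of degree less than `a` at distance at most `R`. -/
lemma gnpProb_close_small_le {n : ℕ} {p t : ℝ} (hp₀ : 0 ≤ p) (hp₁ : p ≤ 1) (ht₀ : 0 < t)
    (ht₁ : t ≤ 1) (a R : ℝ) :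
    gnpProb n p {G | ∃ x y : Fin n, x ≠ y ∧ (G.degree x : ℝ) < a ∧ (G.degree y : ℝ) < a ∧
      G.Reachable x y ∧ (G.dist x y : ℝ) ≤ R} ≤
    ∑ l ∈ Finset.Icc 1 ⌊R⌋₊, (n : ℝ) ^ (l + 1) *
      (t ^ (-(2 * a)) * (p ^ l * (1 - p + p * t) ^ (2 * (n - (l + 1))))) := by
  have hq : 0 ≤ 1 - p := sub_nonneg.2 hp₁
  refine (gnpProb_le_sum hp₀ hp₁ (Finset.Icc 1 ⌊R⌋₊)
    (fun l => {G | ∃ v ∈ Finset.univ.filter (fun v : Fin (l + 1) → Fin n => Function.Injective v),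
      pathEdges v ⊆ G.edgeFinset ∧
        (G.degree (v 0) : ℝ) + G.degree (v (Fin.last l)) < 2 * a}) ?_).trans
    (Finset.sum_le_sum fun l hl => ?_)
  · rintro G ⟨x, y, hxy, hx, hy, hr, hd⟩
    obtain ⟨w, hw, hlen⟩ := hr.exists_path_of_dist
    refine ⟨G.dist x y, Finset.mem_Icc.2 ⟨hr.pos_dist_of_ne hxy, Nat.le_floor hd⟩,
      fun i => w.getVert i, ?_, ?_, ?_⟩
    · simp only [Finset.mem_filter, Finset.mem_univ, true_and]
      intro i j hij
      refine Fin.ext (hw.getVert_injOn ?_ ?_ hij) <;> simp only [Set.mem_ofPred_eq] <;> omega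
    · intro e he
      obtain ⟨i, -, rfl⟩ := Finset.mem_image.1 he
      rw [SimpleGraph.mem_edgeFinset, SimpleGraph.mem_edgeSet]
      exact w.adj_getVert_succ (i.2.trans_eq hlen.symm)
    · have hends : ∀ u z, u = x → z = y → (G.degree u : ℝ) + G.degree z < 2 * a := by
        rintro _ _ rfl rfl
        linarith
      exact hends _ _ w.getVert_zero (hlen ▸ w.getVert_length)
  · refine (gnpProb_le_sum hp₀ hp₁ _ _ fun G hG => hG).trans ?_
    refine (Finset.sum_le_card_nsmul _ _ _ fun v hv =>
      gnpProb_path_le hp₀ hp₁ ht₀ ht₁ (Finset.mem_Icc.1 hl).1 (Finset.mem_filter.1 hv).2).trans ?_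
    rw [nsmul_eq_mul]
    refine mul_le_mul_of_nonneg_right ?_ (by positivity)
    have := Finset.card_filter_le (Finset.univ : Finset (Fin (l + 1) → Fin n))
      (fun v => Function.Injective v)
    rw [Finset.card_univ, Fintype.card_fun, Fintype.card_fin, Fintype.card_fin] at this
    exact_mod_cast this

/-- For an edge probability of order `log n / n`, the first moment bound with `t = 1 / 64`
is eventually smaller than `n ^ (-9 / 100)`. -/
lemma eventually_first_moment_le (k : ℕ) (hk : 1 ≤ k) : ∀ᶠ n : ℕ in atTop,
    ∀ p : ℝ, p = (Real.log n + ((k : ℝ) + 1) * Real.log (Real.log n) -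
        Real.log (Real.log (Real.log n))) / n →
      0 ≤ p ∧ p ≤ 1 ∧
      ∑ l ∈ Finset.Icc 1 ⌊3 / 4 * (Real.log n / Real.log (Real.log n))⌋₊, (n : ℝ) ^ (l + 1) *
        ((1 / 64 : ℝ) ^ (-(2 * (Real.log n / 100))) *
          (p ^ l * (1 - p + p * (1 / 64)) ^ (2 * (n - (l + 1))))) ≤
      (n : ℝ) ^ (-(9 : ℝ) / 100) := by
  have hL : Tendsto (fun n : ℕ => Real.log n) atTop atTop :=
    Real.tendsto_log_atTop.comp tendsto_natCast_atTop_atTop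
  have hM : Tendsto (fun n : ℕ => Real.log (Real.log n)) atTop atTop :=
    Real.tendsto_log_atTop.comp hL
  have hsq : ∀ᶠ n : ℕ in atTop, 2 * ((k : ℝ) + 2) * Real.log n ^ 2 ≤ n := by
    have h := (Real.isLittleO_pow_log_id_atTop (n := 2)).bound
      (show (0 : ℝ) < 1 / (2 * ((k : ℝ) + 2)) by positivity)
    filter_upwards [tendsto_natCast_atTop_atTop.eventually h] with n hn
    rw [Real.norm_of_nonneg (by positivity), id, Real.norm_of_nonneg (by positivity)] at hn
    have hk₀ : (0 : ℝ) < 2 * ((k : ℝ) + 2) := by positivity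
    rw [div_mul_eq_mul_div, one_mul, le_div_iff₀ hk₀] at hn
    linarith
  have hlog : ∀ᶠ n : ℕ in atTop, Real.log (Real.log n) ≤ 2 / 100 * Real.log n := by
    have h := Real.isLittleO_log_id_atTop.bound (show (0 : ℝ) < 2 / 100 by norm_num)
    filter_upwards [hL.eventually h, hL.eventually_ge_atTop 1] with n hn hn1
    rw [id, Real.norm_of_nonneg (by positivity : (0 : ℝ) ≤ Real.log n)] at hn
    exact (Real.le_norm_self _).trans hn
  filter_upwards [hL.eventually_ge_atTop (50 * (2 + ((k : ℝ) + 1))), hM.eventually_ge_atTop 1,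
    hsq, hlog, eventually_ge_atTop 1] with n hLn hMn hsq hlog hn p hp
  set L := Real.log n with hLdef
  set M := Real.log L with hMdef
  have hn₀ : (0 : ℝ) < n := by exact_mod_cast hn
  have hk₀ : (0 : ℝ) ≤ k := by positivity
  have hL₀ : 0 < L := by linarith
  have hM₀ : 0 < M := by linarith
  have hML : M ≤ L := by linarith
  have hexpL : Real.exp L = n := Real.exp_log hn₀
  have hexpM : Real.exp M = L := Real.exp_log hL₀
  have hloM : 0 ≤ Real.log M := Real.log_nonneg hMn
  have hhiM : Real.log M ≤ (k + 1) * M := by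
    have := Real.log_le_sub_one_of_pos hM₀
    nlinarith
  have hpn : n * p = L + (k + 1) * M - Real.log M := by
    rw [hp]
    field_simp
  have hlo : L ≤ n * p := by linarith
  have hhi : n * p ≤ L + (k + 1) * M := by linarith
  have hhi' : n * p ≤ (k + 2) * L := by nlinarith
  have hp₀ : 0 ≤ p := by
    by_contra h
    nlinarith [mul_pos hn₀ (neg_pos.2 (not_le.1 h))]
  have hp₁ : p ≤ 1 := by
    refine le_of_mul_le_mul_left ?_ hn₀
    nlinarith
  refine ⟨hp₀, hp₁, ?_⟩
  have hlognp : Real.log (n * p) ≤ M + (k + 1) * M / L := by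
    have hpos : 0 < L + (k + 1) * M := by positivity
    have hfac : L + (k + 1) * M = L * (1 + (k + 1) * M / L) := by field_simp
    calc Real.log (n * p) ≤ Real.log (L + (k + 1) * M) := Real.log_le_log (by linarith) hhi
      _ = M + Real.log (1 + (k + 1) * M / L) := by
        rw [hfac, Real.log_mul hL₀.ne' (by positivity)]
      _ ≤ M + (k + 1) * M / L := by
        have : 0 < 1 + (k + 1) * M / L := by positivity
        linarith [Real.log_le_sub_one_of_pos this]
  have hlog64 : Real.log 64 ≤ 4.16 := by
    rw [show (64 : ℝ) = 2 ^ 6 by norm_num, Real.log_pow]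
    push_cast
    linarith [Real.log_two_lt_d9]
  have hterm : ∀ l ∈ Finset.Icc 1 ⌊3 / 4 * (L / M)⌋₊, (n : ℝ) ^ (l + 1) *
        ((1 / 64 : ℝ) ^ (-(2 * (L / 100))) *
          (p ^ l * (1 - p + p * (1 / 64)) ^ (2 * (n - (l + 1))))) ≤
      Real.exp (-(11 / 100) * L) := by
    intro l hl
    have hlR : (l : ℝ) ≤ 3 / 4 * (L / M) :=
      (Nat.le_floor_iff (by positivity)).1 (Finset.mem_Icc.1 hl).2
    have hLM : L / M ≤ L := div_le_self hL₀.le hMn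
    have h₁ : (n * p) ^ l ≤ Real.exp (3 / 4 * L + 3 / 4 * (k + 1)) := by
      have hnp : 0 < n * p := by linarith
      rw [← Real.exp_log hnp, ← Real.exp_nat_mul]
      refine Real.exp_le_exp.2 ?_
      calc (l : ℝ) * Real.log (n * p) ≤ 3 / 4 * (L / M) * (M + (k + 1) * M / L) :=
            mul_le_mul hlR hlognp (Real.log_nonneg (by linarith)) (by positivity)
        _ = 3 / 4 * L + 3 / 4 * (k + 1) := by field_simp
    have h₂ : (1 / 64 : ℝ) ^ (-(2 * (L / 100))) ≤ Real.exp (4.16 * L / 50) := by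
      rw [Real.rpow_def_of_pos (by norm_num), one_div, Real.log_inv]
      refine Real.exp_le_exp.2 ?_
      nlinarith
    have h₃ : (1 - p + p * (1 / 64)) ^ (2 * (n - (l + 1))) ≤
        Real.exp (-(63 / 32) * (L - 1)) := by
      have hbase : 1 - p + p * (1 / 64) ≤ Real.exp (-(63 / 64 * p)) := by
        have := Real.add_one_le_exp (-(63 / 64 * p))
        linarith
      refine (pow_le_pow_left₀ (by linarith) hbase _).trans ?_
      rw [← Real.exp_nat_mul]
      refine Real.exp_le_exp.2 ?_
      have hsub : (n : ℝ) - (l + 1) ≤ ((n - (l + 1) : ℕ) : ℝ) := by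
        rw [sub_le_iff_le_add]
        exact_mod_cast le_tsub_add
      have hpl : p * (l + 1) ≤ 1 := by
        have hl' : (l : ℝ) + 1 ≤ 2 * L := by linarith
        refine le_of_mul_le_mul_left ?_ hn₀
        calc n * (p * (l + 1)) = n * p * (l + 1) := by ring
          _ ≤ (k + 2) * L * (2 * L) := mul_le_mul hhi' hl' (by positivity) (by positivity)
          _ = 2 * (k + 2) * L ^ 2 := by ring
          _ ≤ n * 1 := by linarith
      have := mul_le_mul_of_nonneg_left hsub hp₀
      push_cast
      nlinarith
    calc (n : ℝ) ^ (l + 1) * ((1 / 64 : ℝ) ^ (-(2 * (L / 100))) *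
          (p ^ l * (1 - p + p * (1 / 64)) ^ (2 * (n - (l + 1)))))
        = Real.exp L * (n * p) ^ l * (1 / 64 : ℝ) ^ (-(2 * (L / 100))) *
          (1 - p + p * (1 / 64)) ^ (2 * (n - (l + 1))) := by
          rw [hexpL, mul_pow]
          ring
      _ ≤ Real.exp L * Real.exp (3 / 4 * L + 3 / 4 * (k + 1)) * Real.exp (4.16 * L / 50) *
          Real.exp (-(63 / 32) * (L - 1)) := by
          have : 0 ≤ 1 - p + p * (1 / 64) := by linarith
          gcongr
      _ ≤ Real.exp (-(11 / 100) * L) := by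
          rw [← Real.exp_add, ← Real.exp_add, ← Real.exp_add]
          refine Real.exp_le_exp.2 ?_
          linarith
  refine (Finset.sum_le_card_nsmul _ _ _ hterm).trans ?_
  rw [nsmul_eq_mul, Nat.card_Icc, Nat.add_sub_cancel]
  have hfloor : (⌊3 / 4 * (L / M)⌋₊ : ℝ) ≤ L := by
    refine (Nat.floor_le (by positivity)).trans ?_
    have : L / M ≤ L := div_le_self hL₀.le hMn
    linarith
  calc (⌊3 / 4 * (L / M)⌋₊ : ℝ) * Real.exp (-(11 / 100) * L)
      ≤ Real.exp M * Real.exp (-(11 / 100) * L) := by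
        rw [hexpM]
        gcongr
    _ ≤ Real.exp (L * (-9 / 100)) := by
        rw [← Real.exp_add]
        refine Real.exp_le_exp.2 ?_
        linarith
    _ = (n : ℝ) ^ (-(9 : ℝ) / 100) := by rw [Real.rpow_def_of_pos hn₀]

/-- Almost surely `G(n, p(n))` contains no two distinct small vertices (degree `< log n/100`)
within distance at most `(3/4)·D`, where `D = log n / log log n`; moreover for all
sufficiently large `n` the probability of such a pair is at most `n^(-9/100)`. -/
theorem no_close_small_vertices_as (k : ℕ) (hk : 1 ≤ k) :
    Tendsto (fun n : ℕ =>
      gnpProb n ((Real.log n + ((k : ℝ) + 1) * Real.log (Real.log n) -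
          Real.log (Real.log (Real.log n))) / n)
        {G : SimpleGraph (Fin n) | ∃ x y : Fin n, x ≠ y ∧
          (G.degree x : ℝ) < Real.log n / 100 ∧ (G.degree y : ℝ) < Real.log n / 100 ∧
          G.Reachable x y ∧
          (G.dist x y : ℝ) ≤ 3 / 4 * (Real.log n / Real.log (Real.log n))})
      atTop (nhds 0) ∧
    ∃ N : ℕ, ∀ n ≥ N,
      gnpProb n ((Real.log n + ((k : ℝ) + 1) * Real.log (Real.log n) -
          Real.log (Real.log (Real.log n))) / n)
        {G : SimpleGraph (Fin n) | ∃ x y : Fin n, x ≠ y ∧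
          (G.degree x : ℝ) < Real.log n / 100 ∧ (G.degree y : ℝ) < Real.log n / 100 ∧
          G.Reachable x y ∧
          (G.dist x y : ℝ) ≤ 3 / 4 * (Real.log n / Real.log (Real.log n))} ≤
      (n : ℝ) ^ (-(9 : ℝ) / 100) := by
  have h := eventually_first_moment_le k hk
  have hbound := h.mono fun n hn =>
    (gnpProb_close_small_le (hn _ rfl).1 (hn _ rfl).2.1 (by norm_num) (by norm_num) _ _).trans
      (hn _ rfl).2.2
  refine ⟨squeeze_zero' (h.mono fun n hn => gnpProb_nonneg (hn _ rfl).1 (hn _ rfl).2.1 _)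
    hbound ?_, eventually_atTop.1 hbound⟩
  simpa only [neg_div, Function.comp_def] using (tendsto_rpow_neg_atTop (show (0 : ℝ) < 9 / 100 by norm_num)).comp
    tendsto_natCast_atTop_atTop
end
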